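/- Let G be a finite morphic p-group. Then either G is abelian and homocyclic, or p is odd and G is isomorphic to the nonabelian group of order p³ and exponent p. -/

import Mathlib

/-- A group is morphic if for every pair of normal subgroups `N₁, N₂`,
`G/N₁ ≅ N₂` holds if and only if `G/N₂ ≅ N₁`. -/
def IsMorphic (G : Type*) [Group G] : Prop :=
  ∀ N₁ N₂ : Subgroup G, ∀ _h₁ : N₁.Normal, ∀ _h₂ : N₂.Normal,
    (Nonempty ((G ⧸ N₁) ≃* N₂) ↔ Nonempty ((G ⧸ N₂) ≃* N₁))

/-- The Heisenberg group over `ZMod p`: for `p` an odd prime this is the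
nonabelian group of order `p ^ 3` and exponent `p`. -/
@[ext]
structure Heisenberg (p : ℕ) where
  x : ZMod p
  y : ZMod p
  z : ZMod p

namespace Heisenberg

variable {p : ℕ}

instance : Mul (Heisenberg p) :=
  ⟨fun a b => ⟨a.x + b.x, a.y + b.y, a.z + b.z + a.x * b.y⟩⟩

instance : One (Heisenberg p) := ⟨⟨0, 0, 0⟩⟩

instance : Inv (Heisenberg p) := ⟨fun a => ⟨-a.x, -a.y, -a.z + a.x * a.y⟩⟩

theorem mul_def (a b : Heisenberg p) :
    a * b = ⟨a.x + b.x, a.y + b.y, a.z + b.z + a.x * b.y⟩ := rfl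

theorem one_def : (1 : Heisenberg p) = ⟨0, 0, 0⟩ := rfl

theorem inv_def (a : Heisenberg p) : a⁻¹ = ⟨-a.x, -a.y, -a.z + a.x * a.y⟩ := rfl

instance : Group (Heisenberg p) where
  mul_assoc a b c := by ext <;> simp [mul_def] <;> ring
  one_mul a := by ext <;> simp [mul_def, one_def]
  mul_one a := by ext <;> simp [mul_def, one_def]
  inv_mul_cancel a := by ext <;> simp [mul_def, one_def, inv_def] <;> ring

end Heisenberg


namespace Morph
open Subgroup
open scoped commutatorElement
set_option linter.unusedSectionVars false
universe u

section basics
variable {p : ℕ} [hp : Fact p.Prime] {G : Type u} [Group G] [Finite G]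

theorem pos_p : 0 < p := hp.out.pos

/-- index-`p` subgroups of a `p`-group are normal -/
theorem normal_of_index (hG : IsPGroup p G) {M : Subgroup G} (hM : M.index = p) : M.Normal := by
  apply Subgroup.normal_of_index_eq_minFac_card
  obtain ⟨n, hn⟩ := IsPGroup.iff_card.1 hG
  rw [hM, hn]
  have : n ≠ 0 := by
    rintro rfl
    have := M.index_dvd_card
    rw [hM, hn, pow_zero] at this
    exact hp.out.one_lt.ne' (Nat.dvd_one.1 this)
  rw [Nat.Prime.pow_minFac hp.out this]

theorem exists_index_p (hG : IsPGroup p G) {K : Subgroup G} (hK : K ≠ ⊤) :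
    ∃ L : Subgroup G, K ≤ L ∧ L.index = p := by
  obtain ⟨n, hn⟩ := IsPGroup.iff_card.1 hG
  obtain ⟨k, hk⟩ := IsPGroup.iff_card.1 (hG.to_subgroup K)
  have hkn : k < n := by
    have h1 : Nat.card K < Nat.card G := by
      rcases (Subgroup.card_le_card_group K).lt_or_eq with h | h
      · exact h
      · exact absurd (Subgroup.eq_top_of_card_eq K h) hK
    rw [hn, hk] at h1
    exact (Nat.pow_lt_pow_iff_right hp.out.one_lt).1 h1
  obtain ⟨L, hL, hKL⟩ := Sylow.exists_subgroup_card_pow_prime_le p (n := k) (m := n - 1)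
    (by rw [hn]; exact pow_dvd_pow _ (by omega)) K hk (by omega)
  refine ⟨L, hKL, ?_⟩
  have h := L.card_mul_index
  rw [hL, hn] at h
  obtain ⟨m, rfl⟩ : ∃ m, n = m + 1 := ⟨n - 1, by omega⟩
  rw [Nat.add_sub_cancel, pow_succ] at h
  exact Nat.eq_of_mul_eq_mul_left (pow_pos hp.out.pos _) h

theorem eq_of_relIndex_prime {A B C : Subgroup G} (hAC : A ≤ C) (hne : ¬ C ≤ A) (hCB : C ≤ B)
    (h : A.relIndex B = p) : C = B := by
  have h1 := Subgroup.relIndex_mul_relIndex A C B hAC hCB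
  rw [h] at h1
  rcases (Nat.dvd_prime hp.out).1 (Dvd.intro _ h1) with h2 | h2
  · exact absurd (Subgroup.relIndex_eq_one.1 h2) hne
  · rw [h2] at h1
    have : C.relIndex B = 1 := by
      have := pos_p (p := p)
      nlinarith [Nat.eq_of_mul_eq_mul_left (pos_p (p := p)) (h1.trans (mul_one p).symm)]
    exact le_antisymm hCB (Subgroup.relIndex_eq_one.1 this)

theorem eq_top_of_index_prime {A C : Subgroup G} (hAC : A ≤ C) (hne : ¬ C ≤ A)
    (h : A.index = p) : C = ⊤ :=
  eq_of_relIndex_prime (p := p) hAC hne le_top (by rwa [Subgroup.relIndex_top_right])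

theorem eq_of_index_le {A B : Subgroup G} (hAB : A ≤ B) (hA : A.index = p) (hB : B.index = p) :
    A = B := by
  by_contra hne
  have : B = ⊤ := eq_top_of_index_prime hAB (fun h => hne (le_antisymm hAB h)) hA
  rw [this, Subgroup.index_top] at hB
  exact hp.out.one_lt.ne hB

theorem sup_eq_top {A B : Subgroup G} (hne : A ≠ B) (hA : A.index = p) (hB : B.index = p) :
    A ⊔ B = ⊤ :=
  eq_top_of_index_prime le_sup_left
    (fun h => hne (eq_of_index_le (le_sup_right.trans h) hB hA).symm) hA

theorem sup_zpowers_eq_top {A : Subgroup G} (hA : A.index = p) {g : G} (hg : g ∉ A) :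
    A ⊔ zpowers g = ⊤ :=
  eq_top_of_index_prime le_sup_left
    (fun h => hg (h (le_sup_right (a := A) (mem_zpowers g)))) hA

theorem ne_top_of_index {A : Subgroup G} (hA : A.index = p) : A ≠ ⊤ := by
  rintro rfl
  rw [Subgroup.index_top] at hA
  exact hp.out.one_lt.ne hA

theorem exists_notMem {A : Subgroup G} (hA : A.index = p) : ∃ g, g ∉ A := by
  by_contra h
  push Not at h
  exact ne_top_of_index hA ((eq_top_iff' A).2 h)

theorem relIndex_of_not_le (hG : IsPGroup p G) {A B : Subgroup G} (hA : A.index = p)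
    (hne : ¬ B ≤ A) : A.relIndex B = p := by
  have := normal_of_index hG hA
  rw [← Subgroup.relIndex_sup_left, ← hA,
    eq_top_of_index_prime (C := A ⊔ B) le_sup_left (fun h => hne (le_sup_right.trans h)) hA,
    Subgroup.relIndex_top_right]

theorem not_le_of_ne {A B : Subgroup G} (hne : A ≠ B) (hA : A.index = p) (hB : B.index = p) :
    ¬ B ≤ A := fun h => hne (eq_of_index_le h hB hA).symm

theorem inf_relIndex (hG : IsPGroup p G) {A B : Subgroup G} (hA : A.index = p)
    (hne : ¬ B ≤ A) : (B ⊓ A).relIndex B = p := by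
  rw [Subgroup.inf_relIndex_left, relIndex_of_not_le hG hA hne]

theorem inf_index (hG : IsPGroup p G) {A B : Subgroup G} (hA : A.index = p) (hB : B.index = p)
    (hne : A ≠ B) : (A ⊓ B).index = p * p := by
  rw [← Subgroup.relIndex_mul_index (inf_le_left : A ⊓ B ≤ A), hA,
    inf_relIndex hG hB (not_le_of_ne hne.symm hB hA)]

theorem card_relIndex {A B : Subgroup G} (h : A ≤ B) :
    Nat.card A * A.relIndex B = Nat.card B := by
  have := Subgroup.relIndex_mul_relIndex ⊥ A B bot_le h
  simpa using this

theorem card_map_mul {H : Type*} [Group H] (f : G →* H) (K : Subgroup G) :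
    Nat.card (K.map f) * Nat.card (f.ker ⊓ K : Subgroup G) = Nat.card K := by
  rw [← Subgroup.relIndex_ker, mul_comm, ← Subgroup.inf_relIndex_right, card_relIndex inf_le_right]

theorem card_map_mk (N K : Subgroup G) [N.Normal] :
    Nat.card (K.map (QuotientGroup.mk' N)) * Nat.card (N ⊓ K : Subgroup G) = Nat.card K := by
  have := card_map_mul (QuotientGroup.mk' N) K
  rwa [QuotientGroup.ker_mk'] at this

theorem card_map_mk_of_le {N K : Subgroup G} [N.Normal] (h : N ≤ K) :
    Nat.card (K.map (QuotientGroup.mk' N)) * Nat.card N = Nat.card K := by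
  have := card_map_mk N K
  rwa [inf_eq_left.2 h] at this

theorem pow_mem_of_index (hG : IsPGroup p G) {M : Subgroup G} (hM : M.index = p) (x : G) :
    x ^ p ∈ M := by
  have := normal_of_index hG hM
  rw [← hM]; exact Subgroup.pow_index_mem M x

theorem commutator_mem_of_index (hG : IsPGroup p G) {M : Subgroup G} (hM : M.index = p) (x y : G) :
    ⁅x, y⁆ ∈ M := by
  have := normal_of_index hG hM
  have hc : Nat.card (G ⧸ M) = p := hM
  have := isCyclic_of_prime_card hc
  rw [← QuotientGroup.eq_one_iff, ← QuotientGroup.mk'_apply, map_commutatorElement,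
    commutatorElement_eq_one_iff_mul_comm]
  have := IsCyclic.isMulCommutative (α := G ⧸ M)
  exact this.is_comm.comm _ _

/-- nontrivial normal subgroup of a `p`-group contains a central element of order `p` -/
theorem exists_central (hG : IsPGroup p G) {K : Subgroup G} [K.Normal] (hK : K ≠ ⊥) :
    ∃ z ∈ K, z ∈ center G ∧ orderOf z = p := by
  have hd : p ∣ Nat.card K := by
    rcases (hG.to_subgroup K).card_eq_or_dvd with h | h
    · exact absurd (Subgroup.card_eq_one.1 h) hK
    · exact h
  have h1 : ∃ b : K, b ∈ MulAction.fixedPoints (ConjAct G) K ∧ (1 : K) ≠ b := by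
    apply IsPGroup.exists_fixed_point_of_prime_dvd_card_of_fixed_point (p := p)
      (G := ConjAct G) (hG.of_equiv ConjAct.toConjAct) K hd (a := 1)
    intro g
    simp
  obtain ⟨b, hb, hb1⟩ := h1
  have hbc : (b : G) ∈ center G := by
    rw [Subgroup.mem_center_iff]
    intro g
    have := congrArg (Subtype.val) (hb (ConjAct.toConjAct g))
    rw [ConjAct.Subgroup.val_conj_smul, ConjAct.toConjAct_smul] at this
    exact mul_inv_eq_iff_eq_mul.1 this
  have hd2 : p ∣ Nat.card (K ⊓ center G : Subgroup G) := by
    rcases (hG.to_subgroup (K ⊓ center G)).card_eq_or_dvd with h | h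
    · have := (Subgroup.card_eq_one.1 h)
      have h3 : (b : G) ∈ K ⊓ center G := ⟨b.2, hbc⟩
      rw [this, Subgroup.mem_bot] at h3
      exact absurd (Subtype.ext h3.symm) hb1
    · exact h
  obtain ⟨z, hz⟩ := exists_prime_orderOf_dvd_card' p hd2
  exact ⟨z, z.2.1, z.2.2, by rw [Subgroup.orderOf_coe, hz]⟩
end basics
end Morph

namespace Morph
open Subgroup
open scoped commutatorElement
set_option linter.unusedSectionVars false
universe u

section derived
variable {p : ℕ} [hp : Fact p.Prime] {G : Type u} [Group G] [Finite G]

/-- the part of morphicity used: quotients by order `p` are isomorphic to index `p` subgroups -/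
def HM (p : ℕ) (G : Type u) [Group G] : Prop :=
  ∀ M N : Subgroup G, M.index = p → ∀ _ : N.Normal, Nat.card N = p → Nonempty ((G ⧸ N) ≃* M)

theorem HM_of_morphic (hG : IsPGroup p G) (h : IsMorphic G) : HM p G := by
  intro M N hM hN hc
  have := normal_of_index hG hM
  exact (h M N this hN).1 ⟨mulEquivOfPrimeCardEq (p := p) hM hc⟩

theorem comm_sup {A B C D : Subgroup G} [D.Normal] (h1 : ⁅A, C⁆ ≤ D) (h2 : ⁅B, C⁆ ≤ D) :
    ⁅A ⊔ B, C⁆ ≤ D := by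
  have key : ∀ X : Subgroup G, ⁅X, C⁆ ≤ D ↔
      X ≤ (centralizer ((C.map (QuotientGroup.mk' D) : Subgroup _) : Set (G ⧸ D))).comap
        (QuotientGroup.mk' D) := by
    intro X
    rw [← Subgroup.map_le_iff_le_comap, ← Subgroup.commutator_eq_bot_iff_le_centralizer,
      ← Subgroup.map_commutator, Subgroup.map_eq_bot_iff, QuotientGroup.ker_mk']
  rw [key] at h1 h2 ⊢
  exact sup_le h1 h2

theorem comm_sup' {A B C D : Subgroup G} [D.Normal] (h1 : ⁅C, A⁆ ≤ D) (h2 : ⁅C, B⁆ ≤ D) :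
    ⁅C, A ⊔ B⁆ ≤ D := by
  rw [Subgroup.commutator_comm] at *
  exact comm_sup h1 h2

theorem comm_zpowers (g : G) (D : Subgroup G) : ⁅zpowers g, zpowers g⁆ ≤ D := by
  rw [Subgroup.commutator_le]
  rintro _ ⟨a, rfl⟩ _ ⟨b, rfl⟩
  have : ⁅g ^ a, g ^ b⁆ = 1 := by
    rw [commutatorElement_eq_one_iff_commute]
    exact (Commute.refl g).zpow_zpow a b
  simp [this, D.one_mem]

theorem transfer {M N : Subgroup G} [N.Normal] (e : (G ⧸ N) ≃* M) {K : Subgroup G} (hK : K ≤ M) :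
    ∃ L : Subgroup G, N ≤ L ∧ L.index = K.relIndex M ∧
      Nat.card (⁅K, K⁆ : Subgroup G) =
        Nat.card ((⁅L, L⁆ : Subgroup G).map (QuotientGroup.mk' N)) := by
  let g : (G ⧸ N) →* G := M.subtype.comp e.toMonoidHom
  have hg : Function.Injective g := M.subtype_injective.comp e.injective
  let f : G →* G := g.comp (QuotientGroup.mk' N)
  have hr : f.range = M := by
    ext x
    constructor
    · rintro ⟨y, rfl⟩
      exact (e (QuotientGroup.mk' N y)).2
    · intro hx
      obtain ⟨y, hy⟩ := QuotientGroup.mk'_surjective N (e.symm ⟨x, hx⟩)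
      refine ⟨y, ?_⟩
      change ((e (QuotientGroup.mk' N y) : M) : G) = x
      rw [hy]; simp
  refine ⟨K.comap f, ?_, ?_, ?_⟩
  · intro x hx
    have h1 : QuotientGroup.mk' N x = 1 := (QuotientGroup.eq_one_iff x).2 hx
    change g (QuotientGroup.mk' N x) ∈ K
    rw [h1, map_one]; exact K.one_mem
  · rw [Subgroup.index_comap, hr]
  · have h1 : (K.comap f).map f = K := by
      rw [Subgroup.map_comap_eq, hr, inf_eq_right.2 hK]
    have h2 : ⁅K, K⁆ = ((⁅K.comap f, K.comap f⁆ : Subgroup G).map (QuotientGroup.mk' N)).map g := by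
      rw [Subgroup.map_map, Subgroup.map_commutator]
      change _ = ⁅(K.comap f).map f, (K.comap f).map f⁆
      rw [h1]
    conv_lhs => rw [h2]
    exact Subgroup.card_map_of_injective hg

theorem normal_zpowers {z : G} (hz : z ∈ center G) : (zpowers z).Normal := by
  have h : zpowers z ≤ center G := by rwa [zpowers_le]
  exact ⟨fun n hn g => by
    have := Subgroup.mem_center_iff.1 (h hn) g
    rw [this]; simpa using hn⟩

theorem derived_ne_bot (hna : center G ≠ ⊤) : (⁅(⊤ : Subgroup G), ⊤⁆ : Subgroup G) ≠ ⊥ := by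
  intro h
  exact hna ((commutator_eq_bot_iff_center_eq_top G).1 h)

/-- all index `p` subgroups have derived subgroup of index `p` in the derived subgroup of the group -/
theorem card_derived (hG : IsPGroup p G) (h : HM p G) (hna : center G ≠ ⊤)
    {M : Subgroup G} (hM : M.index = p) :
    Nat.card (⁅M, M⁆ : Subgroup G) * p = Nat.card (⁅(⊤ : Subgroup G), ⊤⁆ : Subgroup G) := by
  obtain ⟨z, hz, hzc, ho⟩ := exists_central hG (derived_ne_bot hna)
  have hN := normal_zpowers hzc
  have hcard : Nat.card (zpowers z) = p := by rw [Nat.card_zpowers, ho]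
  obtain ⟨e⟩ := h M (zpowers z) hM hN hcard
  obtain ⟨L, -, hL, hc⟩ := transfer e (le_refl M)
  rw [Subgroup.relIndex_self, Subgroup.index_eq_one] at hL
  subst hL
  rw [hc]
  have := card_map_mk_of_le (N := zpowers z) (K := ⁅(⊤ : Subgroup G), ⊤⁆) (by rwa [zpowers_le])
  rwa [hcard] at this

/-- if `N` lies in every derived subgroup, index `p` subgroups of index `p` subgroups have derived
subgroups of index `p ^ 2` in `G'`. -/
theorem card_derived2 (hG : IsPGroup p G) (h : HM p G) (hna : center G ≠ ⊤)
    {N : Subgroup G} (hN : N.Normal) (hNc : Nat.card N = p)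
    (hNL : ∀ L : Subgroup G, L.index = p → N ≤ ⁅L, L⁆)
    {M K : Subgroup G} (hM : M.index = p) (hKM : K ≤ M) (hK : K.relIndex M = p) :
    Nat.card (⁅K, K⁆ : Subgroup G) * (p * p) =
      Nat.card (⁅(⊤ : Subgroup G), ⊤⁆ : Subgroup G) := by
  obtain ⟨e⟩ := h M N hM hN hNc
  obtain ⟨L, -, hL, hc⟩ := transfer e hKM
  rw [hK] at hL
  have h2 := card_map_mk_of_le (hNL L hL)
  rw [hNc] at h2
  rw [hc, ← mul_assoc, h2, card_derived hG h hna hL]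

/-- index of the centralizer when commutators land in a group of order `p` -/
theorem comm_index {A N : Subgroup G} {g : G} (hN : Nat.card N = p) (h1 : ∀ x ∈ A, ⁅x, g⁆ ∈ N)
    (h2 : ∀ x ∈ A, ∀ y ∈ A, x * ⁅y, g⁆ = ⁅y, g⁆ * x) :
    (A ⊓ centralizer {g}).relIndex A ∣ p := by
  let f : A →* N :=
    { toFun := fun x => ⟨⁅(x : G), g⁆, h1 x x.2⟩
      map_one' := by ext; simp
      map_mul' := by
        rintro ⟨x, hx⟩ ⟨y, hy⟩
        ext
        change ⁅x * y, g⁆ = ⁅x, g⁆ * ⁅y, g⁆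
        have e1 : ⁅x * y, g⁆ = (x * ⁅y, g⁆) * x⁻¹ * ⁅x, g⁆ := by
          simp only [commutatorElement_def]; group
        have e2 := h1 x hx
        have e3 := h1 y hy
        have : IsCyclic N := isCyclic_of_prime_card hN
        have e4 := (IsCyclic.isMulCommutative (α := N)).is_comm.comm ⟨_, e2⟩ ⟨_, e3⟩
        have e5 : ⁅x, g⁆ * ⁅y, g⁆ = ⁅y, g⁆ * ⁅x, g⁆ := congrArg Subtype.val e4
        rw [e1, h2 x hx y hy, e5]; group }
  have hk : f.ker = (centralizer {g}).subgroupOf A := by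
    ext ⟨x, hx⟩
    rw [MonoidHom.mem_ker, Subgroup.mem_subgroupOf, mem_centralizer_singleton_iff,
      Subtype.ext_iff]
    change ⁅x, g⁆ = 1 ↔ _
    rw [commutatorElement_eq_one_iff_mul_comm]
  rw [Subgroup.inf_relIndex_left, Subgroup.relIndex, ← hk, Subgroup.index_ker, ← hN]
  exact Subgroup.card_subgroup_dvd_card _

theorem lemB0 (hG : IsPGroup p G) {A : Subgroup G} (hA : A.index = p)
    (hAc : ⁅A, A⁆ = (⊥ : Subgroup G))
    (hc : Nat.card (⁅(⊤ : Subgroup G), ⊤⁆ : Subgroup G) = p) :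
    ∃ B : Subgroup G, B.index = p ∧ B ≠ A ∧ ⁅B, B⁆ = (⊥ : Subgroup G) := by
  obtain ⟨g, hg⟩ := exists_notMem hA
  have hAn := normal_of_index hG hA
  have hAc' : ∀ x ∈ A, ∀ y ∈ A, x * y = y * x := by
    intro x hx y hy
    rw [← commutatorElement_eq_one_iff_mul_comm, ← Subgroup.mem_bot, ← hAc]
    exact Subgroup.commutator_mem_commutator hx hy
  have hi := comm_index (A := A) (g := g) hc
    (fun x _ => Subgroup.commutator_mem_commutator (mem_top x) (mem_top g))
    (fun x hx y _ => hAc' x hx _ (commutator_mem_of_index hG hA _ _))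
  set C := A ⊓ centralizer {g} with hC
  have hcomm : ∀ X : Subgroup G, X ≤ C → ⁅X ⊔ zpowers g, X ⊔ zpowers g⁆ ≤ (⊥ : Subgroup G) := by
    intro X hX
    have c1 : ⁅X, X⁆ ≤ (⊥ : Subgroup G) := by
      rw [← hAc]; exact Subgroup.commutator_mono (hX.trans inf_le_left) (hX.trans inf_le_left)
    have c2 : ⁅X, zpowers g⁆ ≤ (⊥ : Subgroup G) := by
      rw [le_bot_iff, Subgroup.commutator_eq_bot_iff_le_centralizer]
      refine (hX.trans inf_le_right).trans ?_
      rw [Subgroup.le_centralizer_iff, zpowers_le]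
      rw [Subgroup.mem_centralizer_iff]
      intro x hx
      exact (mem_centralizer_singleton_iff.1 hx)
    refine comm_sup (comm_sup' c1 c2) (comm_sup' ?_ (comm_zpowers g _))
    rw [Subgroup.commutator_comm]; exact c2
  have hne : C ⊔ zpowers g ≠ ⊤ := by
    intro ht
    have := hcomm C le_rfl
    rw [ht, le_bot_iff] at this
    rw [this, Subgroup.card_bot] at hc
    exact hp.out.one_lt.ne hc
  obtain ⟨B, hCB, hB⟩ := exists_index_p hG hne
  have hgB : g ∈ B := hCB (le_sup_right (a := C) (mem_zpowers g))
  have hBA : B ≠ A := fun e => hg (e ▸ hgB)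
  refine ⟨B, hB, hBA, ?_⟩
  have hCBA : C ≤ B ⊓ A := le_inf (le_sup_left.trans hCB) inf_le_left
  have e1 := Subgroup.relIndex_mul_relIndex C (B ⊓ A) A hCBA inf_le_right
  have e2 : (B ⊓ A).relIndex A = p := by
    rw [inf_comm]; exact inf_relIndex hG hB (not_le_of_ne hBA hB hA)
  have e3 : (B ⊓ A).relIndex B = p := inf_relIndex hG hA (not_le_of_ne hBA.symm hA hB)
  have e4 : C.relIndex (B ⊓ A) = 1 := by
    rw [e2] at e1
    rw [← e1] at hi
    have : C.relIndex (B ⊓ A) * p ∣ 1 * p := by simpa using hi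
    exact Nat.dvd_one.1 (Nat.dvd_of_mul_dvd_mul_right hp.out.pos this)
  have e5 : B ⊓ A ≤ C := Subgroup.relIndex_eq_one.1 e4
  have e6 : (B ⊓ A) ⊔ zpowers g = B :=
    eq_of_relIndex_prime (p := p) le_sup_left
      (fun h => hg (inf_le_right (a := B) (h (le_sup_right (a := B ⊓ A) (mem_zpowers g)))))
      (sup_le inf_le_left (by rwa [zpowers_le])) e3
  have := hcomm _ e5
  rw [e6, le_bot_iff] at this
  exact this

section spread
variable (hG : IsPGroup p G)
  (h1 : ∀ M : Subgroup G, M.index = p →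
    Nat.card (⁅M, M⁆ : Subgroup G) * p = Nat.card (⁅(⊤ : Subgroup G), ⊤⁆ : Subgroup G))
include hG h1

theorem derived_eq_of_le {M : Subgroup G} (hM : M.index = p) {D : Subgroup G}
    (hD : Nat.card D * p = Nat.card (⁅(⊤ : Subgroup G), ⊤⁆ : Subgroup G)) (hle : ⁅M, M⁆ ≤ D) :
    ⁅M, M⁆ = D := by
  apply Subgroup.eq_of_le_of_card_ge hle
  have := h1 M hM
  exact (Nat.eq_of_mul_eq_mul_right hp.out.pos (hD.trans this.symm)).le

theorem derived_not_le {M : Subgroup G} (hM : M.index = p) :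
    ¬ ⁅(⊤ : Subgroup G), ⊤⁆ ≤ ⁅M, M⁆ := by
  intro hle
  have := Subgroup.card_le_of_le hle
  rw [← h1 M hM] at this
  have h2 : 0 < Nat.card (⁅M, M⁆ : Subgroup G) := Nat.card_pos
  have := hp.out.two_le
  nlinarith

theorem lemA {L₁ L₂ L₃ : Subgroup G} (i1 : L₁.index = p) (i2 : L₂.index = p) (i3 : L₃.index = p)
    (hne : L₁ ≠ L₂) (hD : ⁅L₁, L₁⁆ = ⁅L₂, L₂⁆) (hle : L₁ ⊓ L₂ ≤ L₃) : ⁅L₃, L₃⁆ = ⁅L₁, L₁⁆ := by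
  have n1 := normal_of_index hG i1
  have hI : ⁅L₁ ⊓ L₂, (⊤ : Subgroup G)⁆ ≤ ⁅L₁, L₁⁆ := by
    rw [← sup_eq_top hne i1 i2]
    exact comm_sup' (Subgroup.commutator_mono inf_le_left le_rfl)
      (by rw [hD]; exact Subgroup.commutator_mono inf_le_right le_rfl)
  have hri : (L₁ ⊓ L₂).relIndex L₃ = p := by
    have := Subgroup.relIndex_mul_index hle
    rw [i3, inf_index hG i1 i2 hne] at this
    exact Nat.eq_of_mul_eq_mul_right hp.out.pos this
  obtain ⟨g, hg, hgn⟩ : ∃ g ∈ L₃, g ∉ L₁ ⊓ L₂ := by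
    by_contra hcon
    push Not at hcon
    have : (L₁ ⊓ L₂).relIndex L₃ = 1 := Subgroup.relIndex_eq_one.2 hcon
    rw [this] at hri
    exact hp.out.one_lt.ne hri
  have hL3 : (L₁ ⊓ L₂) ⊔ zpowers g = L₃ :=
    eq_of_relIndex_prime (p := p) le_sup_left
      (fun h => hgn (h (le_sup_right (a := L₁ ⊓ L₂) (mem_zpowers g))))
      (sup_le hle (by rwa [zpowers_le])) hri
  apply derived_eq_of_le hG h1 i3 (h1 _ i1)
  rw [← hL3]
  have hI' : ∀ X : Subgroup G, ⁅L₁ ⊓ L₂, X⁆ ≤ ⁅L₁, L₁⁆ := fun X =>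
    (Subgroup.commutator_mono le_rfl le_top).trans hI
  refine comm_sup (hI' _) (comm_sup' ?_ (comm_zpowers g _))
  rw [Subgroup.commutator_comm]; exact hI' _

omit hG h1 in
theorem lemC {L₁ L₂ L₃ T D : Subgroup G} [D.Normal] (d1 : ⁅L₁, L₁⁆ ≤ D) (d2 : ⁅L₂, L₂⁆ ≤ D)
    (d3 : ⁅L₃, L₃⁆ ≤ D) (s12 : L₁ ⊔ L₂ = T) (s3 : L₃ ⊔ (L₁ ⊓ L₂) = T) : ⁅T, T⁆ ≤ D := by
  have hI : ⁅L₁ ⊓ L₂, T⁆ ≤ D := by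
    rw [← s12]
    exact comm_sup' ((Subgroup.commutator_mono inf_le_left le_rfl).trans d1)
      ((Subgroup.commutator_mono inf_le_right le_rfl).trans d2)
  have hI' : ⁅L₁ ⊓ L₂, L₃⁆ ≤ D :=
    (Subgroup.commutator_mono le_rfl (by rw [← s3]; exact le_sup_left)).trans hI
  calc ⁅T, T⁆ = ⁅L₃ ⊔ (L₁ ⊓ L₂), T⁆ := by rw [s3]
    _ ≤ D := by
      refine comm_sup ?_ hI
      rw [← s3]
      refine comm_sup' d3 ?_
      rw [Subgroup.commutator_comm]; exact hI'

theorem lemC_top {L₁ L₂ L₃ : Subgroup G} (i1 : L₁.index = p) (i2 : L₂.index = p)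
    (i3 : L₃.index = p) (hne : L₁ ≠ L₂) (hD : ⁅L₁, L₁⁆ = ⁅L₂, L₂⁆) (hD3 : ⁅L₃, L₃⁆ = ⁅L₁, L₁⁆) :
    L₁ ⊓ L₂ ≤ L₃ := by
  by_contra hle
  have n1 := normal_of_index hG i1
  exact derived_not_le hG h1 i1 (lemC le_rfl hD.ge hD3.le (sup_eq_top hne i1 i2)
    (eq_top_of_index_prime le_sup_left (fun h => hle (le_sup_right.trans h)) i3))

theorem lemB {L : Subgroup G} (i1 : L.index = p) :
    ∃ L₂ : Subgroup G, L₂.index = p ∧ L₂ ≠ L ∧ ⁅L₂, L₂⁆ = ⁅L, L⁆ := by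
  have n1 := normal_of_index hG i1
  set D : Subgroup G := ⁅L, L⁆ with hD
  have hDL : D ≤ L := Subgroup.commutator_le_right L L
  let π := QuotientGroup.mk' D
  have hπ : Function.Surjective π := QuotientGroup.mk'_surjective D
  have hker : π.ker = D := QuotientGroup.ker_mk' D
  have hcm : (L.map π).comap π = L := Subgroup.comap_map_eq_self (by rw [hker]; exact hDL)
  have hidx : ∀ B : Subgroup (G ⧸ D), (B.comap π).index = B.index := fun B =>
    Subgroup.index_comap_of_surjective B hπ
  obtain ⟨B, hB, hBne, hBc⟩ := lemB0 (p := p) (hG.to_quotient D) (A := L.map π)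
    (by rw [← hidx, hcm, i1])
    (by rw [← Subgroup.map_commutator, Subgroup.map_eq_bot_iff, hker])
    (by
      rw [← Subgroup.map_top_of_surjective π hπ, ← Subgroup.map_commutator]
      have := card_map_mk_of_le (N := D) (K := ⁅(⊤ : Subgroup G), ⊤⁆)
        (Subgroup.commutator_mono le_top le_top)
      rw [← h1 L i1, mul_comm] at this
      exact Nat.eq_of_mul_eq_mul_left Nat.card_pos this)
  refine ⟨B.comap π, by rw [hidx, hB], ?_, ?_⟩
  · intro e
    apply hBne
    exact (Subgroup.map_comap_eq_self_of_surjective hπ B).symm.trans (congrArg (map π) e)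
  · apply derived_eq_of_le hG h1 (by rw [hidx, hB]) (h1 L i1)
    have : ⁅B.comap π, B.comap π⁆ ≤ π.ker := by
      rw [← Subgroup.map_eq_bot_iff, Subgroup.map_commutator,
        Subgroup.map_comap_eq_self_of_surjective hπ, hBc]
    exact this.trans hker.le
end spread
end derived
end Morph

namespace Morph
open Subgroup
open scoped commutatorElement
set_option linter.unusedSectionVars false
universe u

section spread2
variable {p : ℕ} [hp : Fact p.Prime] {G : Type u} [Group G] [Finite G]

theorem eq_of_le_index {A B : Subgroup G} (h : A ≤ B) (hi : A.index = B.index) : A = B := by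
  have h1 := Subgroup.relIndex_mul_index h
  rw [hi] at h1
  have h2 : 0 < B.index := Nat.pos_of_ne_zero Subgroup.index_ne_zero_of_finite
  have h3 : A.relIndex B = 1 := by
    apply Nat.eq_of_mul_eq_mul_right h2; rw [h1, one_mul]
  exact le_antisymm h (Subgroup.relIndex_eq_one.1 h3)

theorem relIndex_sup_zpowers {K : Subgroup G} [K.Normal] {g : G} (hg : g ^ p ∈ K) :
    K.relIndex (K ⊔ zpowers g) ∣ p := by
  rw [Subgroup.relIndex_sup_left]
  have := Subgroup.relIndex_ker (zpowers g) (QuotientGroup.mk' K)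
  rw [QuotientGroup.ker_mk', MonoidHom.map_zpowers, Nat.card_zpowers] at this
  rw [this]
  apply orderOf_dvd_of_pow_eq_one
  rw [← map_pow]
  exact (QuotientGroup.eq_one_iff _).2 hg

/-- third subgroup of index `p` over the intersection of two -/
theorem exists_third (hG : IsPGroup p G) {A B : Subgroup G} (hA : A.index = p) (hB : B.index = p)
    (hne : A ≠ B) : ∃ C : Subgroup G, C.index = p ∧ A ⊓ B ≤ C ∧ C ≠ A ∧ C ≠ B := by
  have nA := normal_of_index hG hA
  have nB := normal_of_index hG hB
  obtain ⟨a, haA, haB⟩ := SetLike.not_le_iff_exists.1 (not_le_of_ne hne.symm hB hA)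
  obtain ⟨b, hbB, hbA⟩ := SetLike.not_le_iff_exists.1 (not_le_of_ne hne hA hB)
  have habA : a * b ∉ A := fun h => hbA ((A.mul_mem_cancel_left haA).1 h)
  have habB : a * b ∉ B := fun h => haB ((B.mul_mem_cancel_right hbB).1 h)
  have hd := relIndex_sup_zpowers (p := p) (K := A ⊓ B) (g := a * b)
    ⟨pow_mem_of_index hG hA _, pow_mem_of_index hG hB _⟩
  have hnt : (A ⊓ B) ⊔ zpowers (a * b) ≠ ⊤ := by
    intro ht
    rw [ht, Subgroup.relIndex_top_right, inf_index hG hA hB hne] at hd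
    have h1 := Nat.le_of_dvd hp.out.pos hd
    have := hp.out.two_le
    nlinarith
  obtain ⟨C, hC, hCi⟩ := exists_index_p hG hnt
  have habC : a * b ∈ C := hC (le_sup_right (a := A ⊓ B) (mem_zpowers _))
  exact ⟨C, hCi, le_sup_left.trans hC, fun e => habA (e ▸ habC), fun e => habB (e ▸ habC)⟩

variable (hG : IsPGroup p G)
  (h1 : ∀ M : Subgroup G, M.index = p →
    Nat.card (⁅M, M⁆ : Subgroup G) * p = Nat.card (⁅(⊤ : Subgroup G), ⊤⁆ : Subgroup G))
  (h2 : ∀ M K : Subgroup G, M.index = p → K ≤ M → K.relIndex M = p →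
    Nat.card (⁅K, K⁆ : Subgroup G) * (p * p) = Nat.card (⁅(⊤ : Subgroup G), ⊤⁆ : Subgroup G))
include hG h1

theorem interDer_card {A B : Subgroup G} (hA : A.index = p) (hB : B.index = p)
    (hne : ⁅A, A⁆ ≠ ⁅B, B⁆) :
    Nat.card (⁅A, A⁆ ⊓ ⁅B, B⁆ : Subgroup G) * (p * p) =
      Nat.card (⁅(⊤ : Subgroup G), ⊤⁆ : Subgroup G) := by
  have nA := normal_of_index hG hA
  have hle : ∀ X : Subgroup G, ⁅X, X⁆ ≤ ⁅(⊤ : Subgroup G), ⊤⁆ := fun X =>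
    Subgroup.commutator_mono le_top le_top
  have hr : (⁅A, A⁆ : Subgroup G).relIndex ⁅(⊤ : Subgroup G), ⊤⁆ = p := by
    have := card_relIndex (hle A)
    rw [← h1 A hA] at this
    exact Nat.eq_of_mul_eq_mul_left Nat.card_pos this
  have hnl : ¬ ⁅B, B⁆ ≤ ⁅A, A⁆ := fun h =>
    hne (derived_eq_of_le hG h1 hB (h1 A hA) h).symm
  have hs : ⁅A, A⁆ ⊔ ⁅B, B⁆ = ⁅(⊤ : Subgroup G), ⊤⁆ :=
    eq_of_relIndex_prime (p := p) le_sup_left (fun h => hnl (le_sup_right.trans h))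
      (sup_le (hle A) (hle B)) hr
  have h3 : (⁅A, A⁆ ⊓ ⁅B, B⁆ : Subgroup G).relIndex ⁅B, B⁆ = p := by
    rw [Subgroup.inf_relIndex_right, ← Subgroup.relIndex_sup_left, hs, hr]
  have h4 := card_relIndex (inf_le_right : ⁅A, A⁆ ⊓ ⁅B, B⁆ ≤ ⁅B, B⁆)
  rw [h3] at h4
  rw [← mul_assoc, h4, h1 B hB]

include h2

theorem interDer {A B K : Subgroup G} (hA : A.index = p) (hB : B.index = p)
    (hne : ⁅A, A⁆ ≠ ⁅B, B⁆) (hKA : K ≤ A) (hKB : K ≤ B) (hK : K.relIndex A = p) :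
    ⁅K, K⁆ = ⁅A, A⁆ ⊓ ⁅B, B⁆ := by
  apply Subgroup.eq_of_le_of_card_ge
    (le_inf (Subgroup.commutator_mono hKA hKA) (Subgroup.commutator_mono hKB hKB))
  have h3 := interDer_card hG h1 hA hB hne
  rw [← h2 A K hA hKA hK] at h3
  exact (Nat.eq_of_mul_eq_mul_right (Nat.mul_pos hp.out.pos hp.out.pos) h3).le

theorem spread {M : Subgroup G} (iM : M.index = p)
    (hcov : ∀ C : Subgroup G, C.index = p * p → ∃ L : Subgroup G, L.index = p ∧ ¬ C ≤ L) :
    False := by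
  have nM := normal_of_index hG iM
  obtain ⟨M2, iM2, neM2, dM2⟩ := lemB hG h1 iM
  obtain ⟨L1, iL1, hCL1⟩ := hcov (M ⊓ M2) (inf_index hG iM iM2 neM2.symm)
  have nL1 := normal_of_index hG iL1
  have neML1 : M ≠ L1 := fun e => hCL1 (e ▸ inf_le_left)
  have d1 : ⁅M, M⁆ ≠ ⁅L1, L1⁆ := fun e =>
    hCL1 (lemC_top hG h1 iM iM2 iL1 neM2.symm dM2.symm e.symm)
  obtain ⟨L2, iL2, hKL2, neL2M, neL2L1⟩ := exists_third hG iM iL1 neML1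
  have nL2 := normal_of_index hG iL2
  have eM2 : M ⊓ L1 = M ⊓ L2 := eq_of_le_index (le_inf inf_le_left hKL2)
    (by rw [inf_index hG iM iL1 neML1, inf_index hG iM iL2 neL2M.symm])
  have e12 : M ⊓ L1 = L1 ⊓ L2 := eq_of_le_index (le_inf inf_le_right hKL2)
    (by rw [inf_index hG iM iL1 neML1, inf_index hG iL1 iL2 neL2L1.symm])
  have d2 : ⁅M, M⁆ ≠ ⁅L2, L2⁆ := fun e => by
    have h3 := lemC_top hG h1 iM iM2 iL2 neM2.symm dM2.symm e.symm
    have : M ⊓ M2 ≤ M ⊓ L2 := le_inf inf_le_left h3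
    exact hCL1 (this.trans (eM2 ▸ inf_le_right))
  have d12 : ⁅L1, L1⁆ ≠ ⁅L2, L2⁆ := fun e =>
    d1 (lemA hG h1 iL1 iL2 iM neL2L1.symm e (e12 ▸ inf_le_left))
  obtain ⟨P1, iP1, neP1, dP1⟩ := lemB hG h1 iL1
  obtain ⟨P2, iP2, neP2, dP2⟩ := lemB hG h1 iL2
  have nP1 := normal_of_index hG iP1
  have nP2 := normal_of_index hG iP2
  have neMP1 : M ≠ P1 := by rintro rfl; exact d1 dP1
  have neMP2 : M ≠ P2 := by rintro rfl; exact d2 dP2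
  have rel : ∀ {X : Subgroup G}, X.index = p → M ≠ X → (M ⊓ X).relIndex M = p :=
    fun hX hne => inf_relIndex hG hX (not_le_of_ne hne.symm hX iM)
  have k1 := interDer hG h1 h2 iM iL1 d1 inf_le_left inf_le_right (rel iL1 neML1)
  have k2 := interDer hG h1 h2 iM iL2 d2 inf_le_left inf_le_right (rel iL2 neL2M.symm)
  have k3 := interDer hG h1 h2 iM iP1 (dP1 ▸ d1) inf_le_left inf_le_right (rel iP1 neMP1)
  have k4 := interDer hG h1 h2 iM iP2 (dP2 ▸ d2) inf_le_left inf_le_right (rel iP2 neMP2)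
  rw [dP1, ← k1] at k3
  rw [dP2, ← k2, ← eM2] at k4
  -- `Q1 ≰ M`
  have hQ1M : ¬ L1 ⊓ P1 ≤ M := fun h => d1 (lemA hG h1 iL1 iP1 iM neP1.symm dP1.symm h)
  have hQ2M : ¬ L2 ⊓ P2 ≤ M := fun h => d2 (lemA hG h1 iL2 iP2 iM neP2.symm dP2.symm h)
  have hKne : ¬ M ⊓ P1 ≤ M ⊓ L1 := by
    intro h
    have e : M ⊓ P1 = M ⊓ L1 := eq_of_le_index h
      (by rw [inf_index hG iM iL1 neML1, inf_index hG iM iP1 neMP1])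
    have e2 : M ⊓ L1 = L1 ⊓ P1 := eq_of_le_index (le_inf inf_le_right (e ▸ inf_le_right))
      (by rw [inf_index hG iM iL1 neML1, inf_index hG iL1 iP1 neP1.symm])
    exact hQ1M (e2 ▸ inf_le_left)
  have hRP2 : (M ⊓ L1) ⊓ (M ⊓ P1) ≤ M ⊓ P2 := by
    by_contra hcon
    have : ⁅M, M⁆ ≤ ⁅M ⊓ L1, M ⊓ L1⁆ := lemC (L₁ := M ⊓ L1) (L₂ := M ⊓ P1) (L₃ := M ⊓ P2)
      le_rfl k3.le k4.le
      (eq_of_relIndex_prime (p := p) le_sup_left (fun h => hKne (le_sup_right.trans h))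
        (sup_le inf_le_left inf_le_left) (rel iL1 neML1))
      (eq_of_relIndex_prime (p := p) le_sup_left (fun h => hcon (le_sup_right.trans h))
        (sup_le inf_le_left (inf_le_left.trans inf_le_left)) (rel iP2 neMP2))
    rw [k1] at this
    exact d1 (derived_eq_of_le hG h1 iM (h1 L1 iL1) (this.trans inf_le_right))
  have rQ1 : ((L1 ⊓ P1) ⊓ M).relIndex (L1 ⊓ P1) = p := inf_relIndex hG iM hQ1M
  have hRle : (L1 ⊓ P1) ⊓ M ≤ L2 ⊓ P2 := by
    have hx : (L1 ⊓ P1) ⊓ M ≤ (M ⊓ L1) ⊓ (M ⊓ P1) :=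
      le_inf (le_inf inf_le_right (inf_le_left.trans inf_le_left))
        (le_inf inf_le_right (inf_le_left.trans inf_le_right))
    exact le_inf ((hx.trans inf_le_left).trans hKL2) (hx.trans (hRP2.trans inf_le_right))
  have hnle : ¬ L1 ⊓ P1 ≤ L2 ⊓ P2 := fun h =>
    d12 (lemA hG h1 iL1 iP1 iL2 neP1.symm dP1.symm (h.trans inf_le_left)).symm
  have hinf : (L1 ⊓ P1) ⊓ M = (L1 ⊓ P1) ⊓ (L2 ⊓ P2) := by
    by_contra hcon
    have := eq_of_relIndex_prime (p := p) (A := (L1 ⊓ P1) ⊓ M) (B := L1 ⊓ P1)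
      (C := (L1 ⊓ P1) ⊓ (L2 ⊓ P2)) (le_inf inf_le_left hRle)
      (fun h => hcon (le_antisymm (le_inf inf_le_left hRle) h)) inf_le_left rQ1
    exact hnle (this ▸ inf_le_right)
  have hPi : ((L2 ⊓ P2) ⊔ (L1 ⊓ P1)).index = p := by
    have e1 : (L2 ⊓ P2).relIndex ((L2 ⊓ P2) ⊔ (L1 ⊓ P1)) = p := by
      rw [Subgroup.relIndex_sup_left, ← Subgroup.inf_relIndex_left, ← hinf, rQ1]
    have e2 := Subgroup.relIndex_mul_index (le_sup_left : L2 ⊓ P2 ≤ (L2 ⊓ P2) ⊔ (L1 ⊓ P1))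
    rw [e1, inf_index hG iL2 iP2 neP2.symm] at e2
    exact Nat.eq_of_mul_eq_mul_left hp.out.pos e2
  exact d12 ((lemA hG h1 iL1 iP1 hPi neP1.symm dP1.symm le_sup_right).symm.trans
    (lemA hG h1 iL2 iP2 hPi neP2.symm dP2.symm le_sup_left))
end spread2
end Morph

namespace Morph
open Subgroup
open scoped commutatorElement
set_option linter.unusedSectionVars false
universe u

section cent
variable {p : ℕ} [hp : Fact p.Prime] {G : Type u} [Group G] [Finite G]

/-- centralizer of a subgroup -/
abbrev cz (M : Subgroup G) : Subgroup G := centralizer (M : Set G)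

/-- second-centre-like subgroup: elements central modulo `N` -/
def YN (N : Subgroup G) [N.Normal] : Subgroup G := (center (G ⧸ N)).comap (QuotientGroup.mk' N)

theorem mem_YN {N : Subgroup G} [N.Normal] {u : G} : u ∈ YN N ↔ ∀ g, ⁅u, g⁆ ∈ N := by
  rw [YN, Subgroup.mem_comap, Subgroup.mem_center_iff]
  constructor
  · intro h g
    rw [← QuotientGroup.eq_one_iff, ← QuotientGroup.mk'_apply, map_commutatorElement,
      commutatorElement_eq_one_iff_mul_comm]
    exact (h _).symm
  · intro h x
    obtain ⟨g, rfl⟩ := QuotientGroup.mk'_surjective N x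
    have := h g
    rw [← QuotientGroup.eq_one_iff, ← QuotientGroup.mk'_apply, map_commutatorElement,
      commutatorElement_eq_one_iff_mul_comm] at this
    exact this.symm

theorem le_centr_singleton {A : Subgroup G} {u : G} : A ≤ centralizer {u} ↔ u ∈ cz A := by
  rw [Subgroup.mem_centralizer_iff]
  constructor
  · intro h x hx; exact mem_centralizer_singleton_iff.1 (h hx)
  · intro h x hx; exact mem_centralizer_singleton_iff.2 (h x hx)

theorem mem_center_of_top_le {u : G} (h : ⊤ ≤ centralizer {u}) : u ∈ center G := by
  rw [Subgroup.mem_center_iff]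
  intro g
  exact mem_centralizer_singleton_iff.1 (h (mem_top g))

theorem zpowers_le_centr {u g : G} (h : u ∈ centralizer {g}) : zpowers g ≤ centralizer {u} := by
  rw [zpowers_le, mem_centralizer_singleton_iff]
  exact (mem_centralizer_singleton_iff.1 h).symm

theorem center_le_cz (A : Subgroup G) : center G ≤ cz A := by
  intro x hx
  rw [Subgroup.mem_centralizer_iff]
  intro g _
  exact Subgroup.mem_center_iff.1 hx g

theorem le_center_of_card (hG : IsPGroup p G) {N : Subgroup G} (hN : N.Normal)
    (hc : Nat.card N = p) : N ≤ center G := by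
  have hb : N ≠ ⊥ := by
    rintro rfl
    rw [Subgroup.card_bot] at hc
    exact hp.out.one_lt.ne hc
  obtain ⟨z, hzN, hz, ho⟩ := exists_central hG hb
  have : zpowers z = N := Subgroup.eq_of_le_of_card_ge (by rwa [zpowers_le])
    (by rw [hc, Nat.card_zpowers, ho])
  rw [← this, zpowers_le]; exact hz

/-- a group of prime order is generated by any nontrivial element -/
theorem le_of_mem_ne_one {N D : Subgroup G} (hc : Nat.card N = p) {x : G} (hxN : x ∈ N)
    (hxD : x ∈ D) (hx : x ≠ 1) : N ≤ D := by
  have h1 := (Nat.dvd_prime hp.out).1 (hc ▸ Subgroup.card_dvd_of_le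
    (by rw [zpowers_le]; exact hxN : zpowers x ≤ N))
  have h2 : zpowers x = N := by
    apply Subgroup.eq_of_le_of_card_ge (by rwa [zpowers_le])
    rcases h1 with h1 | h1
    · rw [Subgroup.card_eq_one, zpowers_eq_bot] at h1
      exact absurd h1 hx
    · rw [h1, hc]
  rw [← h2, zpowers_le]; exact hxD

theorem card_le_of_relIndex {A B : Subgroup G} (h : A ≤ B) (hd : A.relIndex B ∣ p) :
    Nat.card B ≤ p * Nat.card A := by
  rw [← card_relIndex h, mul_comm]
  exact Nat.mul_le_mul_right _ (Nat.le_of_dvd hp.out.pos hd)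

theorem card_center_sub (M : Subgroup G) :
    Nat.card (center M) = Nat.card (M ⊓ cz M : Subgroup G) := by
  have : (center M).map M.subtype = M ⊓ cz M := by
    ext x
    simp only [Subgroup.mem_map, Subgroup.mem_inf, Subgroup.mem_center_iff,
      Subgroup.mem_centralizer_iff]
    constructor
    · rintro ⟨⟨y, hy⟩, h, rfl⟩
      exact ⟨hy, fun g hg => congrArg Subtype.val (h ⟨g, hg⟩)⟩
    · rintro ⟨hx, h⟩
      exact ⟨⟨x, hx⟩, fun g => Subtype.ext (h g g.2), rfl⟩
  rw [← this]
  exact (Subgroup.card_map_of_injective M.subtype_injective).symm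

variable (hG : IsPGroup p G) (hHM : HM p G) (hna : center G ≠ ⊤)
include hG hna

theorem exists_N : ∃ N : Subgroup G, N.Normal ∧ Nat.card N = p := by
  have : (⊤ : Subgroup G) ≠ ⊥ := by
    intro h
    exact hna (le_antisymm le_top (h ▸ bot_le))
  obtain ⟨z, -, hz, ho⟩ := exists_central hG this
  exact ⟨zpowers z, normal_zpowers hz, by rw [Nat.card_zpowers, ho]⟩

include hHM
theorem card_center_eq {M₁ M₂ : Subgroup G} (h1 : M₁.index = p) (h2 : M₂.index = p) :
    Nat.card (center M₁) = Nat.card (center M₂) := by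
  obtain ⟨N, hN, hc⟩ := exists_N hG hna
  obtain ⟨e1⟩ := hHM M₁ N h1 hN hc
  obtain ⟨e2⟩ := hHM M₂ N h2 hN hc
  exact Nat.card_congr (centerCongr (e1.symm.trans e2)).toEquiv

theorem center_le {M : Subgroup G} (hM : M.index = p) : center G ≤ M := by
  obtain ⟨M₀, h0, hi0⟩ := exists_index_p hG hna
  have h1 : Nat.card (center G) ≤ Nat.card (M ⊓ cz M : Subgroup G) := by
    rw [← card_center_sub, card_center_eq hG hHM hna hM hi0, card_center_sub]
    exact Subgroup.card_le_of_le (le_inf h0 (center_le_cz _))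
  by_contra hcon
  have ht : M ⊔ center G = ⊤ := eq_top_of_index_prime le_sup_left
    (fun h => hcon (le_sup_right.trans h)) hM
  have h2 : M ⊓ cz M ≤ center G := by
    intro x hx
    apply mem_center_of_top_le
    rw [← ht]
    refine sup_le (le_centr_singleton.2 hx.2) ?_
    intro z hz
    exact mem_centralizer_singleton_iff.2 (Subgroup.mem_center_iff.1 hz x).symm
  have h3 := Subgroup.eq_of_le_of_card_ge h2 h1
  exact hcon (h3 ▸ inf_le_left)

theorem cz_le {M : Subgroup G} (hM : M.index = p) : cz M ≤ M := by
  intro u hu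
  by_contra hcon
  apply hcon
  apply center_le hG hHM hna hM
  apply mem_center_of_top_le
  rw [← sup_zpowers_eq_top hM hcon]
  exact sup_le (le_centr_singleton.2 hu) (zpowers_le_centr (mem_centralizer_singleton_iff.2 rfl))

theorem mem_center_of_cz {M : Subgroup G} (hM : M.index = p) {u g : G} (hu : u ∈ cz M)
    (hg : g ∉ M) (hug : u ∈ centralizer {g}) : u ∈ center G := by
  apply mem_center_of_top_le
  rw [← sup_zpowers_eq_top hM hg]
  exact sup_le (le_centr_singleton.2 hu) (zpowers_le_centr hug)

theorem card_cz_center {M : Subgroup G} (hM : M.index = p) :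
    Nat.card (center M) = Nat.card (cz M) := by
  rw [card_center_sub, inf_eq_right.2 (cz_le hG hHM hna hM)]

theorem card_YN {M N : Subgroup G} (hM : M.index = p) [hN : N.Normal] (hc : Nat.card N = p) :
    Nat.card (YN N) = p * Nat.card (cz M) := by
  obtain ⟨e⟩ := hHM M N hM hN hc
  rw [← card_cz_center hG hHM hna hM, ← Nat.card_congr (centerCongr e).toEquiv]
  have hle : N ≤ YN N := by
    have : (QuotientGroup.mk' N).ker ≤ YN N := MonoidHom.ker_le_comap _ _
    rwa [QuotientGroup.ker_mk'] at this
  have := card_map_mk_of_le hle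
  rw [YN, Subgroup.map_comap_eq_self_of_surjective (QuotientGroup.mk'_surjective N)] at this
  rw [YN, ← this, hc, mul_comm]

omit hHM hna in
theorem YN_relIndex {N A : Subgroup G} [hN : N.Normal] (hc : Nat.card N = p) (hA : A ≤ YN N)
    (g : G) : (A ⊓ centralizer {g}).relIndex A ∣ p := by
  apply comm_index hc
  · intro x hx; exact mem_YN.1 (hA hx) g
  · intro x _ y hy
    exact Subgroup.mem_center_iff.1 (le_center_of_card hG hN hc (mem_YN.1 (hA hy) g)) x

omit hHM hna in
theorem YN_centr_index {N : Subgroup G} [hN : N.Normal] (hc : Nat.card N = p) {u : G}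
    (hu : u ∈ YN N) : (centralizer {u}).index ∣ p := by
  have h := comm_index (A := ⊤) (g := u) hc (p := p) (G := G) ?_ ?_
  · rwa [top_inf_eq, Subgroup.relIndex_top_right] at h
  · intro x _
    rw [← commutatorElement_inv]
    exact N.inv_mem (mem_YN.1 hu x)
  · intro x _ y _
    refine Subgroup.mem_center_iff.1 (le_center_of_card hG hN hc ?_) x
    rw [← commutatorElement_inv]
    exact N.inv_mem (mem_YN.1 hu y)

theorem YN_bound {N : Subgroup G} [hN : N.Normal] (hc : Nat.card N = p) :
    Nat.card (YN N) ≤ p * (p * Nat.card (center G)) := by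
  by_contra hcon
  have hNL : ∀ L : Subgroup G, L.index = p → N ≤ ⁅L, L⁆ := by
    intro L hL
    by_contra hNL
    apply hcon
    have hle : YN N ⊓ L ≤ cz L := by
      intro u hu
      rw [Subgroup.mem_centralizer_iff_commutator_eq_one']
      intro l hl
      by_contra hne
      exact hNL (le_of_mem_ne_one hc (mem_YN.1 hu.1 l)
        (Subgroup.commutator_mem_commutator hu.2 hl) hne)
    obtain ⟨g, hg⟩ := exists_notMem hL
    have b1 := card_le_of_relIndex inf_le_left (YN_relIndex hG hc (inf_le_left : YN N ⊓ L ≤ _) g)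
    have b2 : YN N ⊓ L ⊓ centralizer {g} ≤ center G := fun u hu =>
      mem_center_of_cz hG hHM hna hL (hle hu.1) hg hu.2
    have b3 := Subgroup.card_le_of_le b2
    have b4 : Nat.card (YN N) ≤ p * Nat.card (YN N ⊓ L : Subgroup G) := by
      apply card_le_of_relIndex inf_le_left
      rw [Subgroup.inf_relIndex_left]
      by_cases h : YN N ≤ L
      · rw [Subgroup.relIndex_eq_one.2 h]; exact one_dvd _
      · rw [relIndex_of_not_le hG hL h]
    exact b4.trans (Nat.mul_le_mul_left _ (b1.trans (Nat.mul_le_mul_left _ b3)))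
  obtain ⟨M, -, hM⟩ := exists_index_p hG hna
  refine spread hG (fun M hM => card_derived hG hHM hna hM)
    (fun M K hM hK hKM => card_derived2 hG hHM hna hN hc hNL hM hK hKM) hM ?_
  intro C hC
  by_contra hall
  push Not at hall
  apply hcon
  have hYC : YN N ≤ cz C := by
    intro u hu
    rw [← le_centr_singleton]
    rcases (Nat.dvd_prime hp.out).1 (YN_centr_index hG hc hu) with h | h
    · rw [Subgroup.index_eq_one] at h
      rw [h]; exact le_top
    · exact hall _ h
  have hCt : C ≠ ⊤ := by
    rintro rfl
    rw [Subgroup.index_top] at hC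
    have := hp.out.two_le
    nlinarith
  obtain ⟨L, hCL, hL⟩ := exists_index_p hG hCt
  have hr : C.relIndex L = p := by
    have := Subgroup.relIndex_mul_index hCL
    rw [hL, hC] at this
    exact Nat.eq_of_mul_eq_mul_right hp.out.pos this
  have hLC : ¬ L ≤ C := by
    intro h
    rw [Subgroup.relIndex_eq_one.2 h] at hr
    exact hp.out.one_lt.ne hr
  obtain ⟨a, haL, haC⟩ := SetLike.not_le_iff_exists.1 hLC
  obtain ⟨b, hb⟩ := exists_notMem hL
  have hCa : C ⊔ zpowers a = L := eq_of_relIndex_prime (p := p) le_sup_left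
      (fun h => haC (h (le_sup_right (a := C) (mem_zpowers a))))
      (sup_le hCL (by rwa [zpowers_le])) hr
  have b1 := card_le_of_relIndex inf_le_left (YN_relIndex hG hc (le_refl (YN N)) a)
  have b2 := card_le_of_relIndex inf_le_left
    (YN_relIndex hG hc (inf_le_left : YN N ⊓ centralizer {a} ≤ _) b)
  have b3 : YN N ⊓ centralizer {a} ⊓ centralizer {b} ≤ center G := by
    intro u hu
    refine mem_center_of_cz hG hHM hna hL ?_ hb hu.2
    rw [← le_centr_singleton, ← hCa]
    exact sup_le (le_centr_singleton.2 (hYC hu.1.1)) (zpowers_le_centr hu.1.2)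
  have b4 := Subgroup.card_le_of_le b3
  exact b1.trans (Nat.mul_le_mul_left _ (b2.trans (Nat.mul_le_mul_left _ b4)))

theorem card_cz {M : Subgroup G} (hM : M.index = p) :
    Nat.card (cz M) = p * Nat.card (center G) := by
  obtain ⟨N, hN, hc⟩ := exists_N hG hna
  have hb := YN_bound hG hHM hna hc
  have hpos : 0 < Nat.card (center G) := Nat.card_pos
  have h2 := hp.out.two_le
  have hY : ¬ YN N ≤ center G := by
    intro h
    have h3 := Subgroup.card_le_of_le h
    have h4 := Subgroup.card_le_of_le (center_le_cz M)
    rw [card_YN hG hHM hna hM hc] at h3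
    nlinarith
  obtain ⟨u, hu, huZ⟩ := SetLike.not_le_iff_exists.1 hY
  have hi : (centralizer {u}).index = p := by
    rcases (Nat.dvd_prime hp.out).1 (YN_centr_index hG hc hu) with h | h
    · rw [Subgroup.index_eq_one] at h
      exact absurd (mem_center_of_top_le h.ge) huZ
    · exact h
  rw [card_YN hG hHM hna hi hc] at hb
  have hb2 := Nat.le_of_mul_le_mul_left hb hp.out.pos
  rw [← card_cz_center hG hHM hna hM, card_center_eq hG hHM hna hM hi,
    card_cz_center hG hHM hna hi]
  have h3 := card_relIndex (center_le_cz (centralizer {u}))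
  have h4 : ¬ cz (centralizer {u}) ≤ center G := fun h =>
    huZ (h (le_centr_singleton.1 le_rfl))
  have h5 : p ∣ (center G).relIndex (cz (centralizer {u})) := by
    have : ((center G).subgroupOf (cz (centralizer {u}))).index ≠ 1 := by
      intro h; exact h4 (Subgroup.relIndex_eq_one.1 h)
    obtain ⟨n, hn⟩ := (hG.to_subgroup (cz (centralizer {u}))).index
      ((center G).subgroupOf (cz (centralizer {u})))
    rw [Subgroup.relIndex, hn]
    rw [hn] at this
    exact dvd_pow_self p (by rintro rfl; exact this (pow_zero p))
  have h6 : p ≤ (center G).relIndex (cz (centralizer {u})) := Nat.le_of_dvd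
    (Nat.pos_of_ne_zero (by
      intro h0; rw [h0, mul_zero] at h3
      exact Nat.card_pos.ne h3)) h5
  apply le_antisymm hb2
  rw [← h3, mul_comm]
  exact Nat.mul_le_mul_left _ h6

theorem card_YN' {N : Subgroup G} [hN : N.Normal] (hc : Nat.card N = p) :
    Nat.card (YN N) = p * (p * Nat.card (center G)) := by
  obtain ⟨M, -, hM⟩ := exists_index_p hG hna
  rw [card_YN hG hHM hna hM hc, card_cz hG hHM hna hM]

theorem cz_comm {M : Subgroup G} (hM : M.index = p) {u : G} (hu : u ∈ cz M) (g : G) :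
    ⁅u, g⁆ ∈ center G := by
  have nM := normal_of_index hG hM
  have h1 := card_map_mk_of_le (center_le_cz M)
  rw [card_cz hG hHM hna hM] at h1
  have h2 := Nat.eq_of_mul_eq_mul_right Nat.card_pos h1
  have h3 : ((cz M).map (QuotientGroup.mk' (center G))).Normal :=
    Subgroup.Normal.map inferInstance _ (QuotientGroup.mk'_surjective _)
  have h4 := le_center_of_card (hG.to_quotient (center G)) h3 h2
  have h5 : u ∈ YN (center G) := h4 (Subgroup.mem_map_of_mem _ hu)
  exact mem_YN.1 h5 g
end cent
end Morph

namespace Morph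
open Subgroup
open scoped commutatorElement IsMulCommutative
set_option linter.unusedSectionVars false
universe u

theorem double_count {V W : Type*} [Finite V] [Finite W] [One V] [One W] (r : V → W → Prop)
    (p : ℕ) (h1 : ∀ v, r v 1) (h2 : ∀ w, r 1 w)
    (h3 : ∀ w, w ≠ 1 → Nat.card {v // r v w} = p * p)
    (h4 : ∀ v, v ≠ 1 → Nat.card {w // r v w} = p) :
    Nat.card V + Nat.card W * (p * p) + p = Nat.card W + Nat.card V * p + p * p := by
  classical
  have := Fintype.ofFinite V
  have := Fintype.ofFinite W
  let e : (Σ v, {w // r v w}) ≃ (Σ w, {v // r v w}) :=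
    { toFun := fun x => ⟨x.2.1, x.1, x.2.2⟩
      invFun := fun x => ⟨x.2.1, x.1, x.2.2⟩
      left_inv := fun _ => rfl
      right_inv := fun _ => rfl }
  have hc := Nat.card_congr e
  rw [Nat.card_sigma, Nat.card_sigma] at hc
  rw [← Finset.add_sum_erase _ _ (Finset.mem_univ (1 : V)),
    ← Finset.add_sum_erase _ _ (Finset.mem_univ (1 : W)),
    Finset.sum_congr rfl (fun x hx => h4 x (Finset.ne_of_mem_erase hx)),
    Finset.sum_congr rfl (fun x hx => h3 x (Finset.ne_of_mem_erase hx)),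
    Finset.sum_const, Finset.sum_const, Finset.card_erase_of_mem (Finset.mem_univ _),
    Finset.card_erase_of_mem (Finset.mem_univ _), Finset.card_univ, Finset.card_univ,
    Nat.card_congr (Equiv.subtypeUnivEquiv h2), Nat.card_congr (Equiv.subtypeUnivEquiv h1),
    ← Nat.card_eq_fintype_card, ← Nat.card_eq_fintype_card, smul_eq_mul, smul_eq_mul] at hc
  obtain ⟨a, ha⟩ : ∃ a, Nat.card V = a + 1 := ⟨Nat.card V - 1, by
    have : 0 < Nat.card V := Nat.card_pos
    omega⟩
  obtain ⟨b, hb⟩ : ∃ b, Nat.card W = b + 1 := ⟨Nat.card W - 1, by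
    have : 0 < Nat.card W := Nat.card_pos
    omega⟩
  rw [ha, hb] at hc ⊢
  rw [Nat.add_sub_cancel, Nat.add_sub_cancel] at hc
  linarith

theorem arith_count {p d r : ℕ} (hp : p.Prime) (hr : r ≠ 0)
    (h : p ^ d + p ^ r * (p * p) + p = p ^ r + p ^ d * p + p * p) : r = 1 := by
  have h2 := hp.two_le
  by_contra hne
  obtain ⟨s, rfl⟩ : ∃ s, r = s + 2 := ⟨r - 2, by omega⟩
  have hs : 0 < p ^ s := pow_pos hp.pos s
  rcases Nat.lt_or_ge d 2 with hd | hd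
  · have : d = 0 ∨ d = 1 := by omega
    rcases this with rfl | rfl
    · simp only [pow_zero, pow_add] at h
      nlinarith [mul_pos hs hs, Nat.mul_le_mul h2 h2, Nat.mul_le_mul (Nat.mul_le_mul h2 h2) hs]
    · simp only [pow_one, pow_add] at h
      nlinarith [mul_pos hs hs, Nat.mul_le_mul h2 h2, Nat.mul_le_mul (Nat.mul_le_mul h2 h2) hs]
  · obtain ⟨t, rfl⟩ : ∃ t, d = t + 2 := ⟨d - 2, by omega⟩
    have h3 : p * p ∣ p := by
      have e1 : p * p ∣ p ^ (s + 2) + p ^ (t + 2) * p + p * p := by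
        refine dvd_add (dvd_add ?_ ?_) dvd_rfl
        · exact ⟨p ^ s, by ring⟩
        · exact ⟨p ^ t * p, by ring⟩
      have e2 : p * p ∣ p ^ (t + 2) + p ^ (s + 2) * (p * p) :=
        dvd_add ⟨p ^ t, by ring⟩ ⟨p ^ (s + 2), by ring⟩
      rw [← h] at e1
      exact (Nat.dvd_add_right e2).1 e1
    have := Nat.le_of_dvd hp.pos h3
    nlinarith

section count
variable {p : ℕ} [hp : Fact p.Prime] {G : Type u} [Group G] [Finite G]

/-- the cyclic group of order `p` -/
abbrev Cp (p : ℕ) := Multiplicative (ZMod p)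

instance finHom {A B : Type*} [Group A] [Finite A] [Group B] [Finite B] : Finite (A →* B) :=
  DFunLike.finite _

theorem card_Cp : Nat.card (Cp p) = p := by simp [Cp]

theorem comm_mul_right_of {u g h : G} (hc : ⁅u, h⁆ ∈ center G) : ⁅u, g * h⁆ = ⁅u, g⁆ * ⁅u, h⁆ := by
  have e1 : ⁅u, g * h⁆ = ⁅u, g⁆ * (g * ⁅u, h⁆) * g⁻¹ := by
    simp only [commutatorElement_def]; group
  rw [e1, Subgroup.mem_center_iff.1 hc g]; group

theorem comm_mul_left_of {u v g : G} (hc : ⁅v, g⁆ ∈ center G) : ⁅u * v, g⁆ = ⁅u, g⁆ * ⁅v, g⁆ := by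
  have e1 : ⁅u * v, g⁆ = (u * ⁅v, g⁆) * u⁻¹ * ⁅u, g⁆ := by
    simp only [commutatorElement_def]; group
  rw [e1, Subgroup.mem_center_iff.1 hc u, Subgroup.mem_center_iff.1 hc ⁅u, g⁆]; group

theorem comm_inv_left_of {u g : G} (hc : ⁅u, g⁆ ∈ center G) : ⁅u⁻¹, g⁆ = ⁅u, g⁆⁻¹ := by
  have e := comm_mul_left_of (u := u⁻¹) (v := u) (g := g) hc
  rw [inv_mul_cancel, commutatorElement_one_left] at e
  exact (eq_inv_of_mul_eq_one_left e.symm)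

/-- commutation with `u` as a homomorphism into the centre -/
def cHom (u : G) (h : ∀ g, ⁅u, g⁆ ∈ center G) : G →* center G where
  toFun g := ⟨⁅u, g⁆, h g⟩
  map_one' := by ext; simp
  map_mul' x y := by ext; exact comm_mul_right_of (h y)

/-- the counting relation -/
def rel (φ : G →* Cp p) (ζ : Cp p →* center G) : Prop :=
  ∃ u : G, ∀ g, ⁅u, g⁆ = (ζ (φ g) : G)

/-- graph for fixed `ζ` -/
def grA (ζ : Cp p →* center G) : Subgroup (G × (G →* Cp p)) where
  carrier := {x | ∀ g, ⁅x.1, g⁆ = (ζ (x.2 g) : G)}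
  one_mem' := by intro g; simp
  mul_mem' := by
    rintro ⟨a, f⟩ ⟨b, k⟩ h1 h2 g
    have h1' := h1 g
    have h2' := h2 g
    change ⁅a, g⁆ = (ζ (f g) : G) at h1'
    change ⁅b, g⁆ = (ζ (k g) : G) at h2'
    change ⁅a * b, g⁆ = (ζ (f g * k g) : G)
    rw [comm_mul_left_of (by rw [h2']; exact (ζ (k g)).2), h1', h2', map_mul]
    rfl
  inv_mem' := by
    rintro ⟨a, f⟩ h1 g
    have h1' := h1 g
    change ⁅a, g⁆ = (ζ (f g) : G) at h1'
    change ⁅a⁻¹, g⁆ = (ζ ((f g)⁻¹) : G)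
    rw [comm_inv_left_of (by rw [h1']; exact (ζ (f g)).2), h1', map_inv]
    rfl

/-- graph for fixed `φ` -/
def grB (φ : G →* Cp p) : Subgroup (G × (Cp p →* center G)) where
  carrier := {x | ∀ g, ⁅x.1, g⁆ = (x.2 (φ g) : G)}
  one_mem' := by intro g; simp
  mul_mem' := by
    rintro ⟨a, f⟩ ⟨b, k⟩ h1 h2 g
    have h1' := h1 g
    have h2' := h2 g
    change ⁅a, g⁆ = (f (φ g) : G) at h1'
    change ⁅b, g⁆ = (k (φ g) : G) at h2'
    change ⁅a * b, g⁆ = ((f (φ g) * k (φ g) : center G) : G)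
    rw [comm_mul_left_of (by rw [h2']; exact (k _).2), h1', h2']
    rfl
  inv_mem' := by
    rintro ⟨a, f⟩ h1 g
    have h1' := h1 g
    change ⁅a, g⁆ = (f (φ g) : G) at h1'
    change ⁅a⁻¹, g⁆ = (((f (φ g))⁻¹ : center G) : G)
    rw [comm_inv_left_of (by rw [h1']; exact (f _).2), h1']
    rfl

theorem bij_of_ne_one_Cp {H : Type*} [Group H] (ζ : Cp p →* H) (h : ζ ≠ 1) :
    Function.Injective ζ := by
  rw [← MonoidHom.ker_eq_bot_iff]
  have hd := Subgroup.card_subgroup_dvd_card ζ.ker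
  rw [card_Cp] at hd
  rcases (Nat.dvd_prime hp.out).1 hd with h1 | h1
  · exact Subgroup.card_eq_one.1 h1
  · exfalso; apply h
    have : ζ.ker = ⊤ := Subgroup.eq_top_of_card_eq _ (by rw [h1, card_Cp])
    apply MonoidHom.ext
    intro x
    have hx : x ∈ ζ.ker := this ▸ mem_top x
    exact hx

theorem surj_of_ne_one_Cp {H : Type*} [Group H] (φ : H →* Cp p) (h : φ ≠ 1) :
    Function.Surjective φ := by
  rw [← MonoidHom.range_eq_top]
  have hd := Subgroup.card_subgroup_dvd_card φ.range
  rw [card_Cp] at hd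
  rcases (Nat.dvd_prime hp.out).1 hd with h1 | h1
  · exfalso; apply h
    rw [Subgroup.card_eq_one] at h1
    ext x
    have hx : φ x ∈ φ.range := ⟨x, rfl⟩
    rw [h1, Subgroup.mem_bot] at hx
    simp [hx]
  · exact Subgroup.eq_top_of_card_eq _ (by rw [h1, card_Cp])

variable (hG : IsPGroup p G) (hHM : HM p G) (hna : center G ≠ ⊤)
include hG hHM hna

theorem fibA (ζ : Cp p →* center G) (hζ : ζ ≠ 1) :
    Nat.card {φ : G →* Cp p // rel φ ζ} = p * p := by
  have hinj := bij_of_ne_one_Cp ζ hζ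
  let N : Subgroup G := ζ.range.map (center G).subtype
  have hNc : Nat.card N = p := by
    rw [Subgroup.card_map_of_injective (center G).subtype_injective,
      ← Nat.card_congr (MonoidHom.ofInjective hinj).toEquiv, card_Cp]
  have hNZ : N ≤ center G := by
    rintro _ ⟨x, -, rfl⟩; exact x.2
  have hN : N.Normal := ⟨fun n hn g => by
    have := Subgroup.mem_center_iff.1 (hNZ hn) g
    rw [this]; simpa using hn⟩
  have m1 : (grA ζ).map (MonoidHom.fst G (G →* Cp p)) = YN N := by
    ext u
    constructor
    · rintro ⟨⟨a, f⟩, h, rfl⟩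
      rw [mem_YN]
      intro g
      exact ⟨ζ (f g), ⟨f g, rfl⟩, (h g).symm⟩
    · intro hu
      rw [mem_YN] at hu
      let c := cHom u (fun g => hNZ (hu g))
      have hc : ∀ g, c g ∈ ζ.range := by
        intro g
        obtain ⟨x, hx, hx2⟩ := hu g
        have : c g = x := Subtype.ext hx2.symm
        rw [this]; exact hx
      let e := MonoidHom.ofInjective hinj
      refine ⟨⟨u, e.symm.toMonoidHom.comp (c.codRestrict ζ.range hc)⟩, ?_, rfl⟩
      intro g
      have h1 : e (e.symm (c.codRestrict ζ.range hc g)) = c.codRestrict ζ.range hc g :=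
        e.apply_symm_apply _
      have h2 := congrArg (fun x : ζ.range => ((x : center G) : G)) h1
      exact h2.symm
  have m2 : Nat.card ((grA ζ).map (MonoidHom.snd G (G →* Cp p))) =
      Nat.card {φ : G →* Cp p // rel φ ζ} := by
    apply Nat.card_congr
    apply Equiv.subtypeEquivRight
    intro φ
    constructor
    · rintro ⟨⟨a, f⟩, h, rfl⟩
      exact ⟨a, h⟩
    · rintro ⟨a, h⟩
      exact ⟨⟨a, φ⟩, h, rfl⟩
  have k1 : (MonoidHom.fst G (G →* Cp p)).ker ⊓ grA ζ = ⊥ := by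
    rw [eq_bot_iff]
    rintro ⟨a, f⟩ ⟨h1, h2⟩
    have ha : a = 1 := h1
    subst ha
    have hf : f = 1 := by
      ext g
      have h3 := h2 g
      change ⁅(1 : G), g⁆ = (ζ (f g) : G) at h3
      rw [commutatorElement_one_left] at h3
      have : ζ (f g) = ζ 1 := by rw [map_one]; exact Subtype.ext h3.symm
      simpa using hinj this
    rw [hf]; exact Subgroup.mem_bot.2 rfl
  have k2 : (MonoidHom.snd G (G →* Cp p)).ker ⊓ grA ζ =
      (center G).map (MonoidHom.inl G (G →* Cp p)) := by
    ext ⟨a, f⟩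
    constructor
    · rintro ⟨h1, h2⟩
      have hf : f = 1 := h1
      subst hf
      refine ⟨a, ?_, rfl⟩
      rw [SetLike.mem_coe, Subgroup.mem_center_iff]
      intro g
      have h3 := h2 g
      change ⁅a, g⁆ = ((ζ 1 : center G) : G) at h3
      rw [map_one] at h3
      exact (commutatorElement_eq_one_iff_mul_comm.1 h3).symm
    · rintro ⟨b, hb, he⟩
      obtain ⟨rfl, rfl⟩ := Prod.mk.inj he
      refine ⟨rfl, ?_⟩
      intro g
      change ⁅b, g⁆ = ((ζ 1 : center G) : G)
      rw [map_one]
      exact commutatorElement_eq_one_iff_mul_comm.2 (Subgroup.mem_center_iff.1 hb g).symm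
  have c1 := card_map_mul (MonoidHom.fst G (G →* Cp p)) (grA ζ)
  have c2 := card_map_mul (MonoidHom.snd G (G →* Cp p)) (grA ζ)
  rw [m1, k1, Subgroup.card_bot, mul_one, card_YN' hG hHM hna hNc] at c1
  rw [m2, k2, Subgroup.card_map_of_injective (fun a b h => (Prod.mk.inj h).1), ← c1,
    ← mul_assoc] at c2
  exact Nat.eq_of_mul_eq_mul_right Nat.card_pos c2

theorem fibB (φ : G →* Cp p) (hφ : φ ≠ 1) :
    Nat.card {ζ : Cp p →* center G // rel φ ζ} = p := by
  have hsurj := surj_of_ne_one_Cp φ hφ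
  have hM : φ.ker.index = p := by
    rw [Subgroup.index_ker, MonoidHom.range_eq_top.2 hsurj, Subgroup.card_top, card_Cp]
  have m1 : (grB φ).map (MonoidHom.fst G (Cp p →* center G)) = cz φ.ker := by
    ext u
    constructor
    · rintro ⟨⟨a, f⟩, h, rfl⟩
      rw [Subgroup.mem_centralizer_iff_commutator_eq_one']
      intro g hg
      have h3 := h g
      change ⁅a, g⁆ = ((f (φ g) : center G) : G) at h3
      rw [MonoidHom.mem_ker.1 hg, map_one] at h3
      exact h3
    · intro hu
      let c := cHom u (cz_comm hG hHM hna hM hu)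
      have hc : φ.ker ≤ c.ker := by
        intro g hg
        exact Subtype.ext (Subgroup.mem_centralizer_iff_commutator_eq_one'.1 hu g hg)
      refine ⟨⟨u, φ.liftOfSurjective hsurj ⟨c, hc⟩⟩, ?_, rfl⟩
      intro g
      have : φ.liftOfSurjective hsurj ⟨c, hc⟩ (φ g) = c g :=
        MonoidHom.liftOfRightInverse_comp_apply _ _ _ ⟨c, hc⟩ g
      exact (congrArg Subtype.val this).symm
  have m2 : Nat.card ((grB φ).map (MonoidHom.snd G (Cp p →* center G))) =
      Nat.card {ζ : Cp p →* center G // rel φ ζ} := by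
    apply Nat.card_congr
    apply Equiv.subtypeEquivRight
    intro ζ
    constructor
    · rintro ⟨⟨a, f⟩, h, rfl⟩
      exact ⟨a, h⟩
    · rintro ⟨a, h⟩
      exact ⟨⟨a, ζ⟩, h, rfl⟩
  have k1 : (MonoidHom.fst G (Cp p →* center G)).ker ⊓ grB φ = ⊥ := by
    rw [eq_bot_iff]
    rintro ⟨a, f⟩ ⟨h1, h2⟩
    have ha : a = 1 := h1
    subst ha
    have hf : f = 1 := by
      apply MonoidHom.ext
      intro x
      obtain ⟨g, rfl⟩ := hsurj x
      have h3 := h2 g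
      change ⁅(1 : G), g⁆ = (f (φ g) : G) at h3
      rw [commutatorElement_one_left] at h3
      exact Subtype.ext h3.symm
    rw [hf]; exact Subgroup.mem_bot.2 rfl
  have k2 : (MonoidHom.snd G (Cp p →* center G)).ker ⊓ grB φ =
      (center G).map (MonoidHom.inl G (Cp p →* center G)) := by
    ext ⟨a, f⟩
    constructor
    · rintro ⟨h1, h2⟩
      have hf : f = 1 := h1
      subst hf
      refine ⟨a, ?_, rfl⟩
      rw [SetLike.mem_coe, Subgroup.mem_center_iff]
      intro g
      have h3 := h2 g
      change ⁅a, g⁆ = 1 at h3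
      exact (commutatorElement_eq_one_iff_mul_comm.1 h3).symm
    · rintro ⟨b, hb, he⟩
      obtain ⟨rfl, rfl⟩ := Prod.mk.inj he
      refine ⟨rfl, ?_⟩
      intro g
      change ⁅b, g⁆ = 1
      exact commutatorElement_eq_one_iff_mul_comm.2 (Subgroup.mem_center_iff.1 hb g).symm
  have c1 := card_map_mul (MonoidHom.fst G (Cp p →* center G)) (grB φ)
  have c2 := card_map_mul (MonoidHom.snd G (Cp p →* center G)) (grB φ)
  rw [m1, k1, Subgroup.card_bot, mul_one, card_cz hG hHM hna hM] at c1
  rw [m2, k2, Subgroup.card_map_of_injective (fun a b h => (Prod.mk.inj h).1), ← c1] at c2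
  exact Nat.eq_of_mul_eq_mul_right Nat.card_pos c2

theorem unique_N {N₁ N₂ : Subgroup G} (n1 : N₁.Normal) (n2 : N₂.Normal) (c1 : Nat.card N₁ = p)
    (c2 : Nat.card N₂ = p) : N₁ ≤ N₂ := by
  have pc : ∀ x : Cp p, x ^ p = 1 := by
    intro x
    have := pow_card_eq_one' (x := x)
    rwa [card_Cp] at this
  have pV : IsPGroup p (G →* Cp p) := fun f => ⟨1, by
    ext g; rw [pow_one, MonoidHom.pow_apply, pc]; rfl⟩
  have pW : IsPGroup p (Cp p →* center G) := fun f => ⟨1, by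
    apply MonoidHom.ext
    intro g; rw [pow_one, MonoidHom.pow_apply, ← map_pow, pc, map_one]; rfl⟩
  obtain ⟨d, hd⟩ := IsPGroup.iff_card.1 pV
  obtain ⟨r, hr⟩ := IsPGroup.iff_card.1 pW
  have hcount := double_count (V := G →* Cp p) (W := Cp p →* center G) rel p
    (fun v => ⟨1, fun g => by simp⟩) (fun w => ⟨1, fun g => by simp⟩)
    (fibA hG hHM hna) (fibB hG hHM hna)
  rw [hd, hr] at hcount
  have key : ∀ N : Subgroup G, N.Normal → Nat.card N = p → ∃ ζ : Cp p →* center G, ζ ≠ 1 ∧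
      ζ.range.map (center G).subtype = N := by
    intro N hN hc
    let e : Cp p ≃* N := mulEquivOfPrimeCardEq (p := p) card_Cp hc
    have hNZ := le_center_of_card hG hN hc
    refine ⟨(Subgroup.inclusion hNZ).comp e.toMonoidHom, ?_, ?_⟩
    · intro h
      have h1 : Function.Injective ((Subgroup.inclusion hNZ).comp e.toMonoidHom) :=
        (Subgroup.inclusion_injective hNZ).comp e.injective
      rw [h] at h1
      have : Subsingleton (Cp p) := ⟨fun a b => h1 rfl⟩
      have h5 := Nat.card_of_subsingleton (1 : Cp p)
      rw [card_Cp] at h5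
      exact hp.out.one_lt.ne' h5
    · rw [MonoidHom.map_range]
      ext x
      constructor
      · rintro ⟨y, rfl⟩; exact (e y).2
      · intro hx
        exact ⟨e.symm ⟨x, hx⟩, by simp⟩
  obtain ⟨ζ₁, hz1, e1⟩ := key N₁ n1 c1
  obtain ⟨ζ₂, hz2, e2⟩ := key N₂ n2 c2
  have hr0 : r ≠ 0 := by
    rintro rfl
    rw [pow_zero] at hr
    have := (Nat.card_eq_one_iff_unique.1 hr).1
    exact hz1 (Subsingleton.elim _ _)
  have hr1 := arith_count hp.out hr0 hcount
  rw [hr1, pow_one] at hr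
  have hz : ζ₁ ∈ zpowers ζ₂ := mem_zpowers_of_prime_card hr hz2
  obtain ⟨k, rfl⟩ := hz
  rw [← e1, ← e2]
  rintro _ ⟨_, ⟨x, rfl⟩, rfl⟩
  refine ⟨ζ₂ (x ^ k), ⟨_, rfl⟩, ?_⟩
  rw [map_zpow]
  rfl
end count
end Morph

namespace Morph
open Subgroup
open scoped commutatorElement IsMulCommutative
set_option linter.unusedSectionVars false
universe u

section power
variable {p : ℕ} [hp : Fact p.Prime] {G : Type u} [Group G] [Finite G]

/-- `p`-th powers of the centre -/
def prc (p : ℕ) (X : Type u) [Group X] : Subgroup (center X) :=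
  (powMonoidHom p : center X →* center X).range

theorem card_prc_congr {X X' : Type u} [Group X] [Group X'] [Finite X] [Finite X'] (e : X ≃* X') :
    Nat.card (prc p X) = Nat.card (prc p X') := by
  have : (prc p X).map (centerCongr e).toMonoidHom = prc p X' := by
    ext y
    constructor
    · rintro ⟨_, ⟨x, rfl⟩, rfl⟩
      exact ⟨centerCongr e x, (map_pow (centerCongr e) x p).symm⟩
    · rintro ⟨y, rfl⟩
      refine ⟨(centerCongr e).symm y ^ p, ⟨_, rfl⟩, ?_⟩
      change centerCongr e ((centerCongr e).symm y ^ p) = y ^ p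
      rw [map_pow, MulEquiv.apply_symm_apply]
  rw [← this]
  exact (Subgroup.card_map_of_injective (centerCongr e).injective).symm

variable (hG : IsPGroup p G) (hHM : HM p G) (hna : center G ≠ ⊤)
include hG hHM hna

theorem pow_comm_of_central {u : G} (h : ∀ g, ⁅u, g⁆ ∈ center G) (g : G) (n : ℕ) :
    ⁅u, g ^ n⁆ = ⁅u, g⁆ ^ n := by
  have := map_pow (cHom u h) g n
  exact congrArg Subtype.val this

theorem comm_pow_of_central {u : G} (h : ∀ g, ⁅u, g⁆ ∈ center G) (g : G) (n : ℕ) :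
    ⁅u ^ n, g⁆ = ⁅u, g⁆ ^ n := by
  induction n with
  | zero => simp
  | succ n ih => rw [pow_succ, comm_mul_left_of (h g), ih, pow_succ]

theorem mem_N {N : Subgroup G} (hN : N.Normal) (hc : Nat.card N = p) {x : G} (hx : x ∈ center G)
    (hxp : x ^ p = 1) : x ∈ N := by
  by_cases h1 : x = 1
  · rw [h1]; exact N.one_mem
  · have ho : orderOf x = p := orderOf_eq_prime hxp h1
    have := unique_N hG hHM hna (normal_zpowers hx) hN (by rw [Nat.card_zpowers, ho]) hc
    exact this (mem_zpowers x)

theorem N_pow {N : Subgroup G} (hc : Nat.card N = p) {x : G} (hx : x ∈ N) : x ^ p = 1 := by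
  have := pow_card_eq_one' (x := (⟨x, hx⟩ : N))
  rw [hc] at this
  exact congrArg Subtype.val this

theorem cz_le_YN {N : Subgroup G} [hN : N.Normal] (hc : Nat.card N = p) {M : Subgroup G}
    (hM : M.index = p) : cz M ≤ YN N := by
  intro u hu
  rw [mem_YN]
  intro g
  have h1 := cz_comm hG hHM hna hM hu
  apply mem_N hG hHM hna hN hc (h1 g)
  rw [← pow_comm_of_central hG hHM hna h1]
  exact Subgroup.mem_centralizer_iff_commutator_eq_one'.1 hu _ (pow_mem_of_index hG hM g)

theorem YN_cases {N : Subgroup G} [hN : N.Normal] (hc : Nat.card N = p) {u : G}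
    (hu : u ∈ YN N) (huZ : u ∉ center G) : (centralizer {u}).index = p := by
  rcases (Nat.dvd_prime hp.out).1 (YN_centr_index hG hc hu) with h | h
  · rw [Subgroup.index_eq_one] at h
    exact absurd (mem_center_of_top_le h.ge) huZ
  · exact h

theorem YN_mem_cz {N : Subgroup G} [hN : N.Normal] (hc : Nat.card N = p) {u : G}
    (hu : u ∈ YN N) : ∃ M : Subgroup G, M.index = p ∧ u ∈ cz M := by
  by_cases huZ : u ∈ center G
  · obtain ⟨M, -, hM⟩ := exists_index_p hG hna
    exact ⟨M, hM, center_le_cz M huZ⟩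
  · exact ⟨_, YN_cases hG hHM hna hc hu huZ, le_centr_singleton.1 le_rfl⟩

theorem YN_pow {N : Subgroup G} [hN : N.Normal] (hc : Nat.card N = p) {u : G}
    (hu : u ∈ YN N) : u ^ p ∈ center G := by
  rw [Subgroup.mem_center_iff]
  intro g
  rw [mem_YN] at hu
  have h1 := comm_pow_of_central hG hHM hna
    (fun g => le_center_of_card hG hN hc (hu g)) g p
  rw [N_pow hG hHM hna hc (hu g)] at h1
  exact (commutatorElement_eq_one_iff_mul_comm.1 h1).symm

theorem center_small : Nat.card (center G) = p ∧ ∀ N : Subgroup G, ∀ _ : N.Normal,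
    Nat.card N = p → ∀ u ∈ YN N, u ^ p = 1 := by
  obtain ⟨N, hN, hc⟩ := exists_N hG hna
  have hNZ := le_center_of_card hG hN hc
  let S : Subgroup G := (prc p G).map (center G).subtype
  have memS : ∀ y, y ∈ S ↔ ∃ x ∈ center G, x ^ p = y := by
    intro y
    constructor
    · rintro ⟨_, ⟨x, rfl⟩, rfl⟩
      exact ⟨x, x.2, rfl⟩
    · rintro ⟨x, hx, rfl⟩
      exact ⟨_, ⟨⟨x, hx⟩, rfl⟩, rfl⟩
  have hSZ : S ≤ center G := by
    rintro _ ⟨x, -, rfl⟩; exact x.2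
  have cardS : Nat.card S * p = Nat.card (center G) := by
    have h1 := card_map_mul (powMonoidHom p : center G →* center G) ⊤
    rw [← MonoidHom.range_eq_map, inf_top_eq, Subgroup.card_top] at h1
    have h2 : ((powMonoidHom p : center G →* center G).ker).map (center G).subtype = N := by
      ext y
      constructor
      · rintro ⟨x, hx, rfl⟩
        exact mem_N hG hHM hna hN hc x.2 (congrArg Subtype.val (MonoidHom.mem_ker.1 hx))
      · intro hy
        exact ⟨⟨y, hNZ hy⟩, Subtype.ext (N_pow hG hHM hna hc hy), rfl⟩
    have h3 : Nat.card ((powMonoidHom p : center G →* center G).ker) = p := by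
      have h4 := Subgroup.card_map_of_injective
        (K := (powMonoidHom p : center G →* center G).ker) (center G).subtype_injective
      rw [h2, hc] at h4
      exact h4.symm
    rw [h3] at h1
    rw [← h1, Subgroup.card_map_of_injective (center G).subtype_injective]
    rfl
  -- powers in the centre of the quotient
  let T : Subgroup (G ⧸ N) := (prc p (G ⧸ N)).map (center (G ⧸ N)).subtype
  have cardT : Nat.card T = Nat.card (prc p (G ⧸ N)) :=
    Subgroup.card_map_of_injective (center (G ⧸ N)).subtype_injective
  have memT : ∀ y ∈ T, ∃ u ∈ YN N, QuotientGroup.mk' N (u ^ p) = y := by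
    rintro _ ⟨_, ⟨⟨x, hx⟩, rfl⟩, rfl⟩
    obtain ⟨u, rfl⟩ := QuotientGroup.mk'_surjective N x
    exact ⟨u, hx, map_pow _ _ _⟩
  have hTle : ∀ A : Subgroup G, (∀ u ∈ YN N, u ^ p ∈ A) →
      Nat.card (prc p (G ⧸ N)) ≤ Nat.card (A.map (QuotientGroup.mk' N)) := by
    intro A hA
    rw [← cardT]
    apply Subgroup.card_le_of_le
    intro y hy
    obtain ⟨u, hu, rfl⟩ := memT y hy
    exact Subgroup.mem_map_of_mem _ (hA u hu)
  have hup : Nat.card (prc p (G ⧸ N)) ≤ Nat.card S := by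
    refine (hTle (center G) (fun u hu => YN_pow hG hHM hna hc hu)).trans ?_
    have := card_map_mk_of_le hNZ
    rw [← cardS, hc] at this
    exact (Nat.eq_of_mul_eq_mul_right hp.out.pos this).le
  have hM : ∀ M : Subgroup G, M.index = p → ∀ x ∈ cz M, x ^ p ∈ S := by
    intro M hM
    let TM : Subgroup G := ((prc p M).map (center M).subtype).map M.subtype
    have memTM : ∀ x ∈ cz M, x ^ p ∈ TM := by
      intro x hx
      have hxM := cz_le hG hHM hna hM hx
      have hxc : (⟨x, hxM⟩ : M) ∈ center M := by
        rw [Subgroup.mem_center_iff]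
        intro g
        exact Subtype.ext (Subgroup.mem_centralizer_iff.1 hx g g.2)
      exact ⟨_, ⟨_, ⟨⟨⟨x, hxM⟩, hxc⟩, rfl⟩, rfl⟩, rfl⟩
    have cardTM : Nat.card TM = Nat.card (prc p M) := by
      rw [Subgroup.card_map_of_injective M.subtype_injective,
        Subgroup.card_map_of_injective (center M).subtype_injective]
    obtain ⟨e⟩ := hHM M N hM hN hc
    have hST : S ≤ TM := by
      intro y hy
      obtain ⟨x, hx, rfl⟩ := (memS y).1 hy
      exact memTM x (center_le_cz M hx)
    have hEq : S = TM := Subgroup.eq_of_le_of_card_ge hST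
      (by rw [cardTM, ← card_prc_congr e]; exact hup)
    intro x hx
    rw [hEq]; exact memTM x hx
  have hY : ∀ u ∈ YN N, u ^ p ∈ S := by
    intro u hu
    obtain ⟨M, hMi, huM⟩ := YN_mem_cz hG hHM hna hc hu
    exact hM M hMi u huM
  have hlow : Nat.card S ≤ Nat.card (prc p (G ⧸ N)) := by
    obtain ⟨M, -, hMi⟩ := exists_index_p hG hna
    obtain ⟨e⟩ := hHM M N hMi hN hc
    rw [card_prc_congr e,
      ← Subgroup.card_map_of_injective (K := prc p M) (center M).subtype_injective,
      ← Subgroup.card_map_of_injective (K := (prc p M).map (center M).subtype)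
        M.subtype_injective]
    apply Subgroup.card_le_of_le
    intro y hy
    obtain ⟨x, hx, rfl⟩ := (memS y).1 hy
    have hxM := center_le hG hHM hna hMi hx
    have hxc : (⟨x, hxM⟩ : M) ∈ center M := by
      rw [Subgroup.mem_center_iff]
      intro g
      exact Subtype.ext (Subgroup.mem_center_iff.1 hx g)
    exact ⟨_, ⟨_, ⟨⟨⟨x, hxM⟩, hxc⟩, rfl⟩, rfl⟩, rfl⟩
  have hS : S = ⊥ := by
    by_contra hne
    have hSn : S.Normal := ⟨fun n hn g => by
      have := Subgroup.mem_center_iff.1 (hSZ hn) g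
      rw [this]; simpa using hn⟩
    obtain ⟨z, hzS, hz, ho⟩ := exists_central hG hne
    have hNS : N ≤ S := by
      refine (unique_N hG hHM hna hN (normal_zpowers hz) hc ?_).trans (by rwa [zpowers_le])
      rw [Nat.card_zpowers, ho]
    have h1 := card_map_mk_of_le hNS
    have h2 := hlow.trans (hTle S hY)
    have h3 : 0 < Nat.card S := Nat.card_pos
    have h4 := hp.out.two_le
    rw [hc] at h1
    nlinarith
  constructor
  · rw [← cardS, hS, Subgroup.card_bot, one_mul]
  · intro N' hN' hc' u hu
    have : N' = N := le_antisymm (unique_N hG hHM hna hN' hN hc' hc)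
      (unique_N hG hHM hna hN hN' hc hc')
    subst this
    have := hY u hu
    rw [hS, Subgroup.mem_bot] at this
    exact this

omit hG hHM hna in
theorem elemIso {A B : Type*} [Group A] [Group B] [Finite A] [Finite B]
    (hA : ∀ a b : A, a * b = b * a) (hB : ∀ a b : B, a * b = b * a)
    (hAp : ∀ a : A, a ^ p = 1) (hBp : ∀ a : B, a ^ p = 1) (hc : Nat.card A = Nat.card B) :
    Nonempty (A ≃* B) := by
  letI iA : CommGroup A := { (inferInstance : Group A) with mul_comm := hA }
  letI iB : CommGroup B := { (inferInstance : Group B) with mul_comm := hB }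
  letI mA : Module (ZMod p) (Additive A) := AddCommGroup.zmodModule (n := p) hAp
  letI mB : Module (ZMod p) (Additive B) := AddCommGroup.zmodModule (n := p) hBp
  have h1 := Module.natCard_eq_pow_finrank (K := ZMod p) (V := Additive A)
  have h2 := Module.natCard_eq_pow_finrank (K := ZMod p) (V := Additive B)
  have h3 : Module.finrank (ZMod p) (Additive A) = Module.finrank (ZMod p) (Additive B) := by
    have : Nat.card (Additive A) = Nat.card (Additive B) := hc
    rw [h1, h2, Nat.card_zmod] at this
    exact Nat.pow_right_injective hp.out.two_le this
  obtain ⟨e⟩ := FiniteDimensional.nonempty_linearEquiv_of_finrank_eq h3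
  exact ⟨MulEquiv.toAdditive.symm e.toAddEquiv⟩

end power
end Morph

namespace Morph
open Subgroup
open scoped commutatorElement
set_option linter.unusedSectionVars false
universe u

section frat
variable {p : ℕ} [hp : Fact p.Prime] {G : Type u} [Group G] [Finite G]

/-- subgroup generated by `p`-th powers and commutators -/
def Fr (p : ℕ) {G : Type*} [Group G] (H : Subgroup G) : Subgroup G :=
  closure ({x | ∃ a ∈ H, a ^ p = x} ∪ {x | ∃ a ∈ H, ∃ b ∈ H, ⁅a, b⁆ = x})

theorem Fr_le_iff {H K : Subgroup G} :
    Fr p H ≤ K ↔ (∀ a ∈ H, a ^ p ∈ K) ∧ (∀ a ∈ H, ∀ b ∈ H, ⁅a, b⁆ ∈ K) := by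
  rw [Fr, Subgroup.closure_le, Set.union_subset_iff]
  constructor
  · rintro ⟨h1, h2⟩
    exact ⟨fun a ha => h1 ⟨a, ha, rfl⟩, fun a ha b hb => h2 ⟨a, ha, b, hb, rfl⟩⟩
  · rintro ⟨h1, h2⟩
    refine ⟨?_, ?_⟩
    · rintro _ ⟨a, ha, rfl⟩; exact h1 a ha
    · rintro _ ⟨a, ha, b, hb, rfl⟩; exact h2 a ha b hb

theorem Fr_map {K : Type*} [Group K] (f : G →* K) (H : Subgroup G) :
    (Fr p H).map f = Fr p (H.map f) := by
  rw [Fr, Fr, MonoidHom.map_closure, Set.image_union]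
  congr 2
  · ext x
    constructor
    · rintro ⟨_, ⟨a, ha, rfl⟩, rfl⟩
      exact ⟨f a, ⟨a, ha, rfl⟩, (map_pow f a p).symm⟩
    · rintro ⟨_, ⟨a, ha, rfl⟩, rfl⟩
      exact ⟨a ^ p, ⟨a, ha, rfl⟩, map_pow f a p⟩
  · ext x
    constructor
    · rintro ⟨_, ⟨a, ha, b, hb, rfl⟩, rfl⟩
      exact ⟨f a, ⟨a, ha, rfl⟩, f b, ⟨b, hb, rfl⟩, (map_commutatorElement f a b).symm⟩
    · rintro ⟨_, ⟨a, ha, rfl⟩, _, ⟨b, hb, rfl⟩, rfl⟩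
      exact ⟨⁅a, b⁆, ⟨a, ha, b, hb, rfl⟩, map_commutatorElement f a b⟩

theorem Fr_iter_map {K : Type*} [Group K] (f : G →* K) (k : ℕ) (H : Subgroup G) :
    ((Fr p)^[k] H).map f = (Fr p)^[k] (H.map f) := by
  induction k generalizing H with
  | zero => rfl
  | succ k ih => rw [Function.iterate_succ_apply, Function.iterate_succ_apply, ih, Fr_map]

theorem Fr_le (H : Subgroup G) : Fr p H ≤ H := by
  rw [Fr_le_iff]
  refine ⟨fun a ha => H.pow_mem ha p, fun a ha b hb => ?_⟩
  rw [commutatorElement_def]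
  exact H.mul_mem (H.mul_mem (H.mul_mem ha hb) (H.inv_mem ha)) (H.inv_mem hb)

theorem Fr_mono {H K : Subgroup G} (h : H ≤ K) : Fr p H ≤ Fr p K := by
  rw [Fr_le_iff]
  have := Fr_le_iff.1 (le_refl (Fr p K))
  exact ⟨fun a ha => this.1 a (h ha), fun a ha b hb => this.2 a (h ha) b (h hb)⟩

theorem Fr_normal {H : Subgroup G} (hH : H.Normal) : (Fr p H).Normal := by
  refine ⟨fun n hn g => ?_⟩
  have h1 : (Fr p H).map (MulAut.conj g).toMonoidHom = Fr p H := by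
    rw [Fr_map]
    congr 1
    ext x
    constructor
    · rintro ⟨y, hy, rfl⟩
      exact hH.conj_mem y hy g
    · intro hx
      refine ⟨g⁻¹ * x * g, ?_, ?_⟩
      · simpa using hH.conj_mem x hx g⁻¹
      · change g * (g⁻¹ * x * g) * g⁻¹ = x
        group
  rw [← h1]
  exact ⟨n, hn, rfl⟩

theorem Fr_iter_normal (k : ℕ) : ((Fr p)^[k] (⊤ : Subgroup G)).Normal := by
  induction k with
  | zero => exact inferInstanceAs (⊤ : Subgroup G).Normal
  | succ k ih => rw [Function.iterate_succ_apply']; exact Fr_normal ih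

theorem Fr_top_le_index (hG : IsPGroup p G) {L : Subgroup G} (hL : L.index = p) :
    Fr p (⊤ : Subgroup G) ≤ L :=
  Fr_le_iff.2 ⟨fun a _ => pow_mem_of_index hG hL a, fun a _ b _ => commutator_mem_of_index hG hL a b⟩

/-- `Fr H` consists of non-generators -/
theorem nongen (hG : IsPGroup p G) {H K : Subgroup G} (hK : K ≤ H) (h : H ≤ K ⊔ Fr p H) :
    K = H := by
  by_contra hne
  have h1 : K.subgroupOf H ≠ ⊤ := by
    intro ht
    rw [Subgroup.subgroupOf_eq_top] at ht
    exact hne (le_antisymm hK ht)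
  obtain ⟨L, hKL, hL⟩ := exists_index_p (hG.to_subgroup H) h1
  have h2 := Fr_top_le_index (hG.to_subgroup H) hL
  have h3 : Fr p H ≤ L.map H.subtype := by
    have := Subgroup.map_mono (f := H.subtype) h2
    rwa [Fr_map, ← MonoidHom.range_eq_map, Subgroup.range_subtype] at this
  have h4 : K ≤ L.map H.subtype := by
    intro x hx
    exact ⟨⟨x, hK hx⟩, hKL hx, rfl⟩
  have h5 := h.trans (sup_le h4 h3)
  apply ne_top_of_index hL
  rw [eq_top_iff']
  intro x
  obtain ⟨y, hy, hyx⟩ := h5 x.2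
  have : y = x := Subtype.ext hyx
  rwa [← this]

/-- the Frattini subgroup is the intersection of the maximal subgroups -/
theorem le_Fr_top {B : Subgroup G}
    (hB : ∀ L : Subgroup G, L.index = p → B ≤ L) : B ≤ Fr p (⊤ : Subgroup G) := by
  intro b hb
  by_contra hbF
  have hfin : {H : Subgroup G | Fr p ⊤ ≤ H ∧ b ∉ H}.Finite := Set.toFinite _
  obtain ⟨H, -, hH⟩ := hfin.exists_le_maximal (a := Fr p ⊤) ⟨le_rfl, hbF⟩
  obtain ⟨⟨hFH, hbH⟩, hmax⟩ := hH
  have hF := Fr_le_iff.1 hFH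
  have hHn : H.Normal := ⟨fun n hn g => by
    have h1 : ⁅g, n⁆ ∈ H := hF.2 g (mem_top _) n (mem_top _)
    have h2 : g * n * g⁻¹ = ⁅g, n⁆ * n := by rw [commutatorElement_def]; group
    rw [h2]; exact H.mul_mem h1 hn⟩
  have hpow : ∀ g, g ∉ H → H.relIndex (H ⊔ zpowers g) = p := by
    intro g hg
    rcases (Nat.dvd_prime hp.out).1
      (relIndex_sup_zpowers (p := p) (hF.1 g (mem_top g))) with h | h
    · exact absurd (Subgroup.relIndex_eq_one.1 h (le_sup_right (a := H) (mem_zpowers g))) hg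
    · exact h
  have htop : H ⊔ zpowers b = ⊤ := by
    rw [eq_top_iff']
    intro g
    by_cases hg : g ∈ H
    · exact le_sup_left (b := zpowers b) hg
    · have hbg : b ∈ H ⊔ zpowers g := by
        by_contra hcon
        exact hg (hmax ⟨hFH.trans le_sup_left, hcon⟩ le_sup_left
          (le_sup_right (a := H) (mem_zpowers g)))
      have : H ⊔ zpowers b = H ⊔ zpowers g := eq_of_relIndex_prime (p := p) le_sup_left
        (fun h => hbH (h (le_sup_right (a := H) (mem_zpowers b))))
        (sup_le le_sup_left (by rwa [zpowers_le])) (hpow g hg)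
      rw [this]; exact le_sup_right (a := H) (mem_zpowers g)
  have hi := hpow b hbH
  rw [htop, Subgroup.relIndex_top_right] at hi
  exact hbH (hB H hi hb)

end frat

section final
variable {p : ℕ} [hp : Fact p.Prime] {G : Type u} [Group G] [Finite G]
variable (hG : IsPGroup p G) (hmor : IsMorphic G) (hna : center G ≠ ⊤)
include hG hmor hna

theorem final_order : Nat.card G = p * (p * p) ∧ ∀ x : G, x ^ p = 1 := by
  have hHM := HM_of_morphic hG hmor
  obtain ⟨hZc, hYp⟩ := center_small hG hHM hna
  have hexp := hYp (center G) inferInstance hZc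
  set Y : Subgroup G := YN (center G) with hYdef
  have cardY : Nat.card Y = p * (p * p) := by
    rw [hYdef, card_YN' hG hHM hna hZc, hZc]
  have cardC : ∀ M : Subgroup G, M.index = p → Nat.card (cz M) = p * p := by
    intro M hM; rw [card_cz hG hHM hna hM, hZc]
  have hCY : ∀ M : Subgroup G, M.index = p → cz M ≤ Y := fun M hM => cz_le_YN hG hHM hna hZc hM
  have h2p := hp.out.two_le
  have hYin : ∀ M : Subgroup G, M.index = p → cz Y ≤ M := by
    intro M hM
    have : ¬ cz M ≤ center G := by
      intro h
      have := Subgroup.card_le_of_le h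
      rw [cardC M hM, hZc] at this
      nlinarith
    obtain ⟨u, hu, huZ⟩ := SetLike.not_le_iff_exists.1 this
    have hui := YN_cases hG hHM hna hZc (hCY M hM hu) huZ
    have e : M = centralizer {u} := eq_of_index_le (le_centr_singleton.2 hu) hM hui
    rw [e]
    intro x hx
    rw [mem_centralizer_singleton_iff]
    exact (Subgroup.mem_centralizer_iff.1 hx u (hCY M hM hu)).symm
  have hFB : Fr p (⊤ : Subgroup G) = cz Y := by
    apply le_antisymm _ (le_Fr_top hYin)
    rw [Fr_le_iff]
    have key : ∀ x, (∀ L : Subgroup G, L.index = p → x ∈ L) → x ∈ cz Y := by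
      intro x hx
      rw [Subgroup.mem_centralizer_iff]
      intro u hu
      obtain ⟨M, hM, huM⟩ := YN_mem_cz hG hHM hna hZc hu
      exact (Subgroup.mem_centralizer_iff.1 huM x (hx M hM)).symm
    exact ⟨fun a _ => key _ fun L hL => pow_mem_of_index hG hL a,
      fun a _ b _ => key _ fun L hL => commutator_mem_of_index hG hL a b⟩
  have nF : (Fr p (⊤ : Subgroup G)).Normal := Fr_normal inferInstance
  have hBi : (Fr p (⊤ : Subgroup G)).index = p * p := by
    obtain ⟨M, -, hM⟩ := exists_index_p hG hna
    have hnl : ¬ Y ≤ cz M := by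
      intro h
      have := Subgroup.card_le_of_le h
      rw [cardC M hM, cardY] at this
      have : 0 < p * p := Nat.mul_pos hp.out.pos hp.out.pos
      nlinarith
    obtain ⟨v, hv, hvM⟩ := SetLike.not_le_iff_exists.1 hnl
    have hvi := YN_cases hG hHM hna hZc hv (fun h => hvM (center_le_cz M h))
    have hne : M ≠ centralizer {v} := fun e => hvM (le_centr_singleton.1 e.le)
    have hrel : (cz M).relIndex Y = p := by
      have := card_relIndex (hCY M hM)
      rw [cardC M hM, cardY, mul_comm p (p * p)] at this
      exact Nat.eq_of_mul_eq_mul_left (Nat.mul_pos hp.out.pos hp.out.pos) this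
    have hY2 : cz M ⊔ zpowers v = Y := eq_of_relIndex_prime (p := p) le_sup_left
      (fun h => hvM (h (le_sup_right (a := cz M) (mem_zpowers v))))
      (sup_le (hCY M hM) (by rwa [zpowers_le])) hrel
    have e : Fr p (⊤ : Subgroup G) = M ⊓ centralizer {v} := by
      apply le_antisymm (le_inf (Fr_top_le_index hG hM) (Fr_top_le_index hG hvi))
      rw [hFB, Subgroup.le_centralizer_iff, ← hY2]
      refine sup_le ?_ ?_
      · exact Subgroup.centralizer_le inf_le_left
      · rw [zpowers_le, ← le_centr_singleton]; exact inf_le_right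
    rw [e, inf_index hG hM hvi hne]
  have hFtop := Fr_le_iff.1 (le_refl (Fr p (⊤ : Subgroup G)))
  -- the isomorphism G / cz M ≅ Fr ⊤
  have iso : ∀ M : Subgroup G, ∀ hM : M.index = p, ∀ _ : (cz M).Normal,
      Nonempty ((G ⧸ cz M) ≃* (Fr p (⊤ : Subgroup G))) := by
    intro M hM hn
    apply (hmor (Fr p ⊤) (cz M) nF hn).1
    apply elemIso (p := p)
    · intro a b
      obtain ⟨a, rfl⟩ := QuotientGroup.mk'_surjective _ a
      obtain ⟨b, rfl⟩ := QuotientGroup.mk'_surjective _ b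
      rw [← commutatorElement_eq_one_iff_mul_comm, ← map_commutatorElement]
      exact (QuotientGroup.eq_one_iff _).2 (hFtop.2 a (mem_top _) b (mem_top _))
    · rintro ⟨a, ha⟩ ⟨b, hb⟩
      exact Subtype.ext (Subgroup.mem_centralizer_iff.1 hb a (cz_le hG hHM hna hM ha))
    · intro a
      obtain ⟨a, rfl⟩ := QuotientGroup.mk'_surjective _ a
      rw [← map_pow]
      exact (QuotientGroup.eq_one_iff _).2 (hFtop.1 a (mem_top _))
    · rintro ⟨a, ha⟩
      exact Subtype.ext (hexp a (hCY M hM ha))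
    · rw [cardC M hM, ← hBi]; rfl
  -- the descending series
  let Φ : ℕ → Subgroup G := fun k => (Fr p)^[k] ⊤
  have Φs : ∀ k, Φ (k + 1) = Fr p (Φ k) := fun k => Function.iterate_succ_apply' _ _ _
  have Φn : ∀ k, (Φ k).Normal := Fr_iter_normal
  have star : ∀ k, ∀ M : Subgroup G, M.index = p →
      Nat.card (Φ (k + 1)) * Nat.card (cz M ⊓ Φ k : Subgroup G) = Nat.card (Φ k) := by
    intro k M hM
    have nM := normal_of_index hG hM
    obtain ⟨e⟩ := iso M hM inferInstance
    rw [← card_map_mk (cz M) (Φ k)]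
    congr 1
    have h1 : Φ (k + 1) = ((Φ k).map (QuotientGroup.mk' (cz M))).map
        ((Fr p (⊤ : Subgroup G)).subtype.comp e.toMonoidHom) := by
      change (Fr p)^[k + 1] ⊤ = (((Fr p)^[k] ⊤).map (QuotientGroup.mk' (cz M))).map _
      rw [Fr_iter_map, Fr_iter_map, Function.iterate_succ_apply]
      congr 1
      rw [Subgroup.map_top_of_surjective _ (QuotientGroup.mk'_surjective (cz M)),
        ← Subgroup.map_map]
      change _ = Subgroup.map (Fr p ⊤).subtype (Subgroup.map e.toMonoidHom ⊤)
      rw [Subgroup.map_top_of_surjective e.toMonoidHom e.surjective, ← MonoidHom.range_eq_map,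
        Subgroup.range_subtype]
    rw [h1]
    exact Subgroup.card_map_of_injective ((Fr p (⊤ : Subgroup G)).subtype_injective.comp e.injective)
  obtain ⟨M₀, -, hM₀⟩ := exists_index_p hG hna
  have pp : 0 < p * p := Nat.mul_pos hp.out.pos hp.out.pos
  have step : ∀ k, Y ≤ Φ k → Nat.card (Φ (k + 1)) * (p * p) = Nat.card (Φ k) := by
    intro k hk
    have := star k M₀ hM₀
    rwa [inf_eq_left.2 ((hCY M₀ hM₀).trans hk), cardC M₀ hM₀] at this
  have hex : ∃ k, ¬ Y ≤ Φ k := by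
    by_contra hall
    push Not at hall
    have hanti : StrictAnti (fun k => Nat.card (Φ k)) := by
      apply strictAnti_nat_of_succ_lt
      intro k
      have h1 := step k (hall k)
      have h3 : 0 < Nat.card (Φ (k + 1)) := Nat.card_pos
      nlinarith
    exact not_strictAnti_of_wellFoundedLT _ hanti
  obtain ⟨k, hk, hk1⟩ : ∃ k, Y ≤ Φ k ∧ ¬ Y ≤ Φ (k + 1) := by
    classical
    have h0 : Nat.find hex ≠ 0 := by
      intro h
      have := Nat.find_spec hex
      rw [h] at this
      exact this le_top
    obtain ⟨k, hk⟩ := Nat.exists_eq_succ_of_ne_zero h0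
    refine ⟨k, ?_, ?_⟩
    · have := Nat.find_min hex (m := k) (by omega)
      exact not_not.1 this
    · have := Nat.find_spec hex
      rwa [hk] at this
  have hstep := step k hk
  have hΦne : Φ (k + 1) ≠ ⊥ := by
    intro h
    rw [h, Subgroup.card_bot, one_mul] at hstep
    have := Subgroup.card_le_of_le hk
    rw [cardY, ← hstep] at this
    nlinarith
  have hZΦ : center G ≤ Φ (k + 1) := by
    have := Φn (k + 1)
    obtain ⟨z, hzS, hz, ho⟩ := exists_central hG hΦne
    refine (unique_N hG hHM hna inferInstance (normal_zpowers hz) hZc ?_).trans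
      (by rwa [zpowers_le])
    rw [Nat.card_zpowers, ho]
  have hYΦ : Y ⊓ Φ (k + 1) = center G := by
    apply le_antisymm
    · intro u hu
      by_contra huZ
      have hM := YN_cases hG hHM hna hZc hu.1 huZ
      have hCΦ : Nat.card (cz (centralizer {u}) ⊓ Φ (k + 1) : Subgroup G) = p * p := by
        have hd : Nat.card (cz (centralizer {u}) ⊓ Φ (k + 1) : Subgroup G) ∣ p ^ 2 := by
          rw [pow_two, ← cardC _ hM]; exact Subgroup.card_dvd_of_le inf_le_left
        obtain ⟨j, hj, hje⟩ := (Nat.dvd_prime_pow hp.out).1 hd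
        have hlt : p < Nat.card (cz (centralizer {u}) ⊓ Φ (k + 1) : Subgroup G) := by
          have hle : center G ≤ cz (centralizer {u}) ⊓ Φ (k + 1) :=
            le_inf (center_le_cz _) hZΦ
          rw [← hZc]
          apply lt_of_le_of_ne (Subgroup.card_le_of_le hle)
          intro he
          have := Subgroup.eq_of_le_of_card_ge hle he.ge
          exact huZ (this ▸ ⟨le_centr_singleton.1 le_rfl, hu.2⟩)
        rw [hje] at hlt ⊢
        have : j = 0 ∨ j = 1 ∨ j = 2 := by omega
        rcases this with rfl | rfl | rfl
        · rw [pow_zero] at hlt; omega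
        · rw [pow_one] at hlt; omega
        · exact pow_two p
      apply hk1
      have hall : ∀ M : Subgroup G, M.index = p → cz M ≤ Φ (k + 1) := by
        intro M hMi
        have h1 := star (k + 1) _ hM
        have h2 := star (k + 1) M hMi
        rw [← h2] at h1
        have h3 := Nat.eq_of_mul_eq_mul_left Nat.card_pos h1
        have : cz M ⊓ Φ (k + 1) = cz M := Subgroup.eq_of_le_of_card_ge inf_le_left
          (by rw [← h3, hCΦ, cardC M hMi])
        exact inf_eq_left.1 this
      intro v hv
      obtain ⟨M, hMi, hvM⟩ := YN_mem_cz hG hHM hna hZc hv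
      exact hall M hMi hvM
    · exact le_inf ((center_le_cz M₀).trans (hCY M₀ hM₀)) hZΦ
  have hYk : Y = Φ k := by
    have hn := Φn (k + 1)
    have hle : Φ (k + 1) ≤ Φ k := by rw [Φs]; exact Fr_le _
    have r1 : (Φ (k + 1)).relIndex Y = p * p := by
      rw [← Subgroup.inf_relIndex_left, hYΦ]
      have := card_relIndex ((center_le_cz M₀).trans (hCY M₀ hM₀))
      rw [hZc, cardY] at this
      exact Nat.eq_of_mul_eq_mul_left hp.out.pos this
    have r2 : (Φ (k + 1)).relIndex (Φ k) = p * p := by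
      have := card_relIndex hle
      rw [← hstep] at this
      exact Nat.eq_of_mul_eq_mul_left Nat.card_pos this
    have r3 := Subgroup.relIndex_mul_relIndex (Φ (k + 1)) (Φ (k + 1) ⊔ Y) (Φ k) le_sup_left
      (sup_le hle hk)
    rw [Subgroup.relIndex_sup_left, r1, r2] at r3
    have r4 : (Φ (k + 1) ⊔ Y).relIndex (Φ k) = 1 :=
      Nat.eq_of_mul_eq_mul_left pp (by rw [r3, mul_one])
    apply nongen hG hk
    rw [← Φs, sup_comm]
    exact Subgroup.relIndex_eq_one.1 r4
  have hcΦ : Nat.card (Φ (k + 1)) = p := by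
    rw [← hYk, cardY] at hstep
    exact Nat.eq_of_mul_eq_mul_right pp hstep
  rcases k with _ | j
  · have hYt : Y = ⊤ := hYk
    refine ⟨?_, fun x => hexp x (hYt ▸ mem_top x)⟩
    rw [← cardY, hYt, Subgroup.card_top]
  · exfalso
    have h1 : Y ≤ cz Y := by
      conv_lhs => rw [hYk, Φs]
      rw [← hFB]
      exact Fr_mono le_top
    apply hΦne
    rw [Φs, ← hYk, eq_bot_iff, Fr_le_iff]
    refine ⟨fun a ha => hexp a ha, fun a ha b hb => ?_⟩
    exact Subgroup.mem_centralizer_iff_commutator_eq_one'.1 (h1 ha) b hb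
end final
end Morph

namespace Morph
open Subgroup
open scoped commutatorElement
set_option linter.unusedSectionVars false
universe u

section heis
variable {p : ℕ} [hp : Fact p.Prime] {G : Type u} [Group G] [Finite G]

theorem pow_congr_zmod {g : G} (hg : g ^ p = 1) {m n : ℕ} (h : (m : ZMod p) = (n : ZMod p)) :
    g ^ m = g ^ n := by
  have := (ZMod.natCast_eq_natCast_iff _ _ _).1 h
  exact pow_eq_pow_iff_modEq.2 (this.of_dvd (orderOf_dvd_of_pow_eq_one hg))

theorem pow_zero_zmod {g : G} (hg : g ^ p = 1) (h1 : g ≠ 1) (x : ZMod p) (h : g ^ x.val = 1) :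
    x = 0 := by
  have ho := orderOf_eq_prime hg h1
  have := orderOf_dvd_of_pow_eq_one h
  rw [ho] at this
  have := Nat.eq_zero_of_dvd_of_lt this (ZMod.val_lt x)
  exact (ZMod.val_eq_zero x).1 this

theorem swap_pow {a b c : G} (hc : ∀ g, g * c = c * g) (hab : a * b = c * (b * a)) (m n : ℕ) :
    a ^ m * b ^ n = c ^ (m * n) * (b ^ n * a ^ m) := by
  have hcn : ∀ k g, g * c ^ k = c ^ k * g := fun k g => (Commute.pow_right (hc g) k)
  have h1 : ∀ n, a * b ^ n = c ^ n * (b ^ n * a) := by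
    intro n
    induction n with
    | zero => simp
    | succ k ih =>
      calc a * b ^ (k + 1) = (a * b ^ k) * b := by rw [pow_succ, mul_assoc]
        _ = c ^ k * (b ^ k * (a * b)) := by rw [ih]; simp only [mul_assoc]
        _ = c ^ k * ((b ^ k * c) * (b * a)) := by rw [hab]; simp only [mul_assoc]
        _ = c ^ (k + 1) * (b ^ (k + 1) * a) := by
          rw [hc]; simp only [pow_succ, mul_assoc]
  induction m with
  | zero => simp
  | succ k ih =>
    calc a ^ (k + 1) * b ^ n = a * (a ^ k * b ^ n) := by rw [pow_succ', mul_assoc]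
      _ = (a * c ^ (k * n)) * (b ^ n * a ^ k) := by rw [ih]; simp only [mul_assoc]
      _ = c ^ (k * n) * ((a * b ^ n) * a ^ k) := by rw [hcn]; simp only [mul_assoc]
      _ = (c ^ (k * n) * c ^ n) * (b ^ n * (a * a ^ k)) := by rw [h1]; simp only [mul_assoc]
      _ = _ := by rw [← pow_add, ← pow_succ']; congr 2; ring

def heisHom (hexp : ∀ x : G, x ^ p = 1) {a b c : G} (hc : ∀ g, g * c = c * g)
    (hab : a * b = c * (b * a)) : Heisenberg p →* G where
  toFun u := c ^ u.z.val * (b ^ u.y.val * a ^ u.x.val)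
  map_one' := by simp [Heisenberg.one_def]
  map_mul' u v := by
    have hcn : ∀ k g, g * c ^ k = c ^ k * g := fun k g => (Commute.pow_right (hc g) k)
    rw [Heisenberg.mul_def]
    simp only
    have e1 : c ^ (u.z + v.z + u.x * v.y).val = c ^ (u.z.val + v.z.val + u.x.val * v.y.val) :=
      pow_congr_zmod (hexp c) (by simp)
    have e2 : b ^ (u.y + v.y).val = b ^ (u.y.val + v.y.val) := pow_congr_zmod (hexp b) (by simp)
    have e3 : a ^ (u.x + v.x).val = a ^ (u.x.val + v.x.val) := pow_congr_zmod (hexp a) (by simp)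
    rw [e1, e2, e3]
    symm
    calc c ^ u.z.val * (b ^ u.y.val * a ^ u.x.val) * (c ^ v.z.val * (b ^ v.y.val * a ^ v.x.val))
        = c ^ u.z.val * (((b ^ u.y.val * a ^ u.x.val) * c ^ v.z.val) * (b ^ v.y.val * a ^ v.x.val)) := by
          simp only [mul_assoc]
      _ = c ^ u.z.val * (c ^ v.z.val * (b ^ u.y.val * ((a ^ u.x.val * b ^ v.y.val) * a ^ v.x.val))) := by
          rw [hcn]; simp only [mul_assoc]
      _ = c ^ u.z.val * (c ^ v.z.val * ((b ^ u.y.val * c ^ (u.x.val * v.y.val)) *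
            (b ^ v.y.val * (a ^ u.x.val * a ^ v.x.val)))) := by
          rw [swap_pow hc hab]; simp only [mul_assoc]
      _ = _ := by rw [hcn]; simp only [pow_add, mul_assoc]

def heisEquiv (p : ℕ) : Heisenberg p ≃ ZMod p × ZMod p × ZMod p where
  toFun u := (u.x, u.y, u.z)
  invFun t := ⟨t.1, t.2.1, t.2.2⟩
  left_inv _ := rfl
  right_inv _ := rfl

theorem heis_iso (hexp : ∀ x : G, x ^ p = 1) (hcard : Nat.card G = p * (p * p))
    (hcomm : ∀ a b : G, ⁅a, b⁆ ∈ center G) (hna : center G ≠ ⊤) :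
    Odd p ∧ Nonempty (G ≃* Heisenberg p) := by
  have hne : ∃ a b : G, a * b ≠ b * a := by
    by_contra! h
    apply hna
    rw [eq_top_iff]
    intro x _
    exact mem_center_iff.2 fun g => h g x
  constructor
  · rcases hp.out.eq_two_or_odd' with h2 | h
    · exfalso
      subst h2
      obtain ⟨a, b, hab⟩ := hne
      apply hab
      have hinv : ∀ x : G, x⁻¹ = x := fun x => by
        rw [inv_eq_iff_mul_eq_one, ← pow_two, hexp]
      calc a * b = (a * b)⁻¹ := (hinv _).symm
        _ = b * a := by rw [mul_inv_rev, hinv, hinv]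
    · exact h
  obtain ⟨a, b, hne⟩ := hne
  obtain ⟨c, hcdef⟩ : ∃ c, c = ⁅a, b⁆ := ⟨_, rfl⟩
  have hc : ∀ g, g * c = c * g := fun g => by
    rw [hcdef]; exact mem_center_iff.1 (hcomm a b) g
  have hab : a * b = c * (b * a) := by rw [hcdef, commutatorElement_def]; group
  have hc1 : c ≠ 1 := by
    rintro rfl
    rw [one_mul] at hab
    exact hne hab
  let f := heisHom hexp hc hab
  have hinj : Function.Injective f := by
    rw [injective_iff_map_eq_one]
    intro u hu
    have hu : c ^ u.z.val * (b ^ u.y.val * a ^ u.x.val) = 1 := hu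
    have hcn : ∀ k g, g * c ^ k = c ^ k * g := fun k g => (Commute.pow_right (hc g) k)
    have hcen : ∀ g, g * (b ^ u.y.val * a ^ u.x.val) = (b ^ u.y.val * a ^ u.x.val) * g := by
      intro g
      rw [eq_inv_of_mul_eq_one_right hu]
      exact Commute.inv_right (hcn _ g)
    have hx : u.x = 0 := by
      apply pow_zero_zmod (hexp c) hc1
      have h1 := hcen b
      have h2 := swap_pow hc hab u.x.val 1
      rw [pow_one, mul_one] at h2
      rw [mul_assoc (b ^ _), h2, ← mul_assoc (b ^ _) (c ^ _), hcn, mul_assoc,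
        ← mul_assoc, ← pow_succ', ← mul_assoc (b ^ _), ← pow_succ] at h1
      exact mul_eq_right.1 h1.symm
    have hy : u.y = 0 := by
      apply pow_zero_zmod (hexp c) hc1
      have h1 := hcen a
      have h2 := swap_pow hc hab 1 u.y.val
      rw [pow_one, one_mul] at h2
      rw [← mul_assoc, h2, mul_assoc, mul_assoc, mul_assoc, ← pow_succ', ← pow_succ] at h1
      exact (mul_eq_right.1 h1)
    have hz : u.z = 0 := by
      apply pow_zero_zmod (hexp c) hc1
      simpa [hx, hy] using hu
    ext
    · exact hx
    · exact hy
    · exact hz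
  have hbij : Function.Bijective f := by
    rw [Nat.bijective_iff_injective_and_card]
    refine ⟨hinj, ?_⟩
    rw [Nat.card_congr (heisEquiv p), hcard]
    simp
  exact ⟨(MulEquiv.ofBijective f hbij).symm⟩

theorem nonabelian_case (hG : IsPGroup p G) (hmor : IsMorphic G) (hna : center G ≠ ⊤) :
    Odd p ∧ Nonempty (G ≃* Heisenberg p) := by
  obtain ⟨hcard, hexp⟩ := final_order hG hmor hna
  refine heis_iso hexp hcard ?_ hna
  have hZ := (center_small hG (HM_of_morphic hG hmor) hna).1
  have hi := (center G).card_mul_index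
  rw [hZ, hcard] at hi
  have hi := Nat.eq_of_mul_eq_mul_left hp.out.pos hi
  have hq : Nat.card (G ⧸ center G) = p ^ 2 := by rw [pow_two]; exact hi
  have hcm := IsPGroup.isMulCommutative_of_card_eq_prime_sq hq
  intro a b
  rw [← QuotientGroup.eq_one_iff]
  have : ((a : G ⧸ center G)) * b = b * a := hcm.is_comm.comm _ _
  rw [commutatorElement_def]
  rw [QuotientGroup.mk_mul, QuotientGroup.mk_mul, QuotientGroup.mk_mul, this,
    ← QuotientGroup.mk_mul, ← QuotientGroup.mk_mul, ← QuotientGroup.mk_mul]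
  have h0 : b * a * a⁻¹ * b⁻¹ = 1 := by group
  rw [h0]; rfl
end heis
end Morph

namespace Morph
open Subgroup
set_option linter.unusedSectionVars false
universe u

section abel
variable {p : ℕ} [hp : Fact p.Prime] {G : Type u} [CommGroup G] [Finite G]

theorem range_quot (N : Subgroup G) (k : ℕ) :
    (powMonoidHom k : G ⧸ N →* G ⧸ N).range = (powMonoidHom k : G →* G).range.map
      (QuotientGroup.mk' N) := by
  ext x
  constructor
  · rintro ⟨y, rfl⟩
    obtain ⟨g, rfl⟩ := QuotientGroup.mk_surjective y
    exact ⟨g ^ k, ⟨g, rfl⟩, rfl⟩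
  · rintro ⟨_, ⟨g, rfl⟩, rfl⟩
    exact ⟨(g : G ⧸ N), rfl⟩

theorem card_range_iso {A B : Type u} [CommGroup A] [CommGroup B] (e : A ≃* B) (k : ℕ) :
    Nat.card (powMonoidHom k : A →* A).range = Nat.card (powMonoidHom k : B →* B).range := by
  have : (powMonoidHom k : B →* B).range = (powMonoidHom k : A →* A).range.map e.toMonoidHom := by
    ext x
    constructor
    · rintro ⟨y, rfl⟩
      exact ⟨(e.symm y) ^ k, ⟨e.symm y, rfl⟩, by simp⟩
    · rintro ⟨_, ⟨g, rfl⟩, rfl⟩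
      exact ⟨e g, by simp⟩
  rw [this]
  exact Nat.card_congr ((powMonoidHom k : A →* A).range.equivMapOfInjective _ e.injective).toEquiv

theorem range_transfer (hG : IsPGroup p G) (h : HM p G) {z w : G} (hz : orderOf z = p)
    (hw : orderOf w = p) (k : ℕ) (hzk : ∃ x : G, x ^ k = z) : ∃ x : G, x ^ k = w := by
  have hz1 : z ≠ 1 := by
    rintro rfl
    rw [orderOf_one] at hz
    exact hp.out.one_lt.ne hz
  have hbt : (⊥ : Subgroup G) ≠ ⊤ := by
    intro hb
    exact hz1 (mem_bot.1 (hb ▸ mem_top z))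
  obtain ⟨M, -, hM⟩ := exists_index_p hG hbt
  have cz : Nat.card (zpowers z) = p := by rw [Nat.card_zpowers, hz]
  have cw : Nat.card (zpowers w) = p := by rw [Nat.card_zpowers, hw]
  obtain ⟨e1⟩ := h M (zpowers z) hM inferInstance cz
  obtain ⟨e2⟩ := h M (zpowers w) hM inferInstance cw
  have hc := card_range_iso (e1.trans e2.symm) k
  rw [range_quot, range_quot] at hc
  set R := (powMonoidHom k : G →* G).range with hR
  have h1 := card_map_mk (zpowers z) R
  have h2 := card_map_mk (zpowers w) R
  have hz' : zpowers z ⊓ R = zpowers z := by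
    rw [inf_eq_left, zpowers_le]
    obtain ⟨x, hx⟩ := hzk
    exact ⟨x, hx⟩
  rw [hz', cz] at h1
  rw [← hc, ← h1] at h2
  have h3 := Nat.eq_of_mul_eq_mul_left Nat.card_pos h2
  have h4 : zpowers w ⊓ R = zpowers w :=
    Subgroup.eq_of_le_of_card_ge inf_le_left (by rw [h3, cw])
  rw [inf_eq_left, zpowers_le] at h4
  obtain ⟨x, hx⟩ := h4
  exact ⟨x, hx⟩

theorem abelian_case (hG : IsPGroup p G) (h : HM p G) :
    ∃ n e : ℕ, Nonempty (G ≃* (Fin n → Multiplicative (ZMod (p ^ e)))) := by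
  classical
  obtain ⟨ι, _, n, hn, ⟨f⟩⟩ := CommGroup.equiv_prod_multiplicative_zmod_of_finite G
  let g : ι → G := fun i => f.symm (Pi.mulSingle i (Multiplicative.ofAdd 1))
  have hfg : ∀ i, f (g i) = Pi.mulSingle i (Multiplicative.ofAdd 1) := fun i => by simp [g]
  have hog : ∀ i, orderOf (g i) = n i := by
    intro i
    rw [← f.orderOf_eq, hfg, orderOf_piMulSingle, orderOf_ofAdd_eq_addOrderOf,
      ZMod.addOrderOf_one]
  have hpw : ∀ i, ∃ e, n i = p ^ (e + 1) := by
    intro i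
    obtain ⟨k, hk⟩ := hG (g i)
    have := orderOf_dvd_of_pow_eq_one hk
    rw [hog] at this
    obtain ⟨e, -, he⟩ := (Nat.dvd_prime_pow hp.out).1 this
    rcases e with _ | e
    · have := hn i
      rw [he] at this; simp at this
    · exact ⟨e, he⟩
  choose e he using hpw
  have hzo : ∀ i, orderOf (g i ^ p ^ e i) = p := by
    intro i
    rw [orderOf_pow_of_dvd (pow_ne_zero _ hp.out.ne_zero)
      (by rw [hog, he]; exact pow_dvd_pow _ (Nat.le_succ _)), hog, he, pow_succ,
      Nat.mul_div_cancel_left _ (pow_pos hp.out.pos _)]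
  have key : ∀ i j, e j ≤ e i := by
    intro i j
    by_contra! hlt
    obtain ⟨x, hx⟩ := range_transfer hG h (hzo j) (hzo i) (n i) ⟨g j ^ p ^ (e j - (e i + 1)), by
      rw [← pow_mul, he, ← pow_add]; congr 2; omega⟩
    have h1 := congrArg (fun y => f y i) hx
    have h2 : (f x i) ^ n i = 1 := by
      have := pow_card_eq_one' (x := f x i)
      rwa [Nat.card_congr Multiplicative.toAdd, Nat.card_zmod] at this
    have h3 : f (g i ^ p ^ e i) = 1 := by
      simp only [map_pow, Pi.pow_apply, h2] at h1
      rw [map_pow, hfg, ← Pi.mulSingle_pow]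
      rw [hfg, Pi.mulSingle_eq_same] at h1
      rw [← h1, Pi.mulSingle_one]
    have h4 : g i ^ p ^ e i = 1 := f.map_eq_one_iff.1 h3
    have h5 := hzo i
    rw [h4, orderOf_one] at h5
    exact hp.out.one_lt.ne h5
  obtain ⟨E, hE⟩ : ∃ E, ∀ i, n i = p ^ E := by
    rcases isEmpty_or_nonempty ι with h0 | ⟨⟨i⟩⟩
    · exact ⟨0, fun i => (IsEmpty.false i).elim⟩
    · exact ⟨e i + 1, fun j => by rw [he, le_antisymm (key i j) (key j i)]⟩
  obtain rfl : n = fun _ => p ^ E := funext hE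
  exact ⟨Fintype.card ι, E, ⟨f.trans (MulEquiv.arrowCongr (Fintype.equivFin ι) (MulEquiv.refl _))⟩⟩
end abel

theorem abelian_case' {p : ℕ} [hp : Fact p.Prime] {G : Type u} [Group G] [Finite G]
    (hcomm : ∀ a b : G, a * b = b * a) (hG : IsPGroup p G) (h : HM p G) :
    ∃ n e : ℕ, Nonempty (G ≃* (Fin n → Multiplicative (ZMod (p ^ e)))) := by
  letI : CommGroup G := { ‹Group G› with mul_comm := hcomm }
  exact abelian_case hG h
end Morph

theorem morphic_p_group_classification (p : ℕ) (hp : p.Prime) (G : Type*) [Group G]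
    [Finite G] (hpG : IsPGroup p G) (hG : IsMorphic G) :
    ((∀ a b : G, a * b = b * a) ∧
        ∃ n e : ℕ, Nonempty (G ≃* (Fin n → Multiplicative (ZMod (p ^ e))))) ∨
      (Odd p ∧ Nonempty (G ≃* Heisenberg p)) := by
  haveI : Fact p.Prime := ⟨hp⟩
  by_cases hna : Subgroup.center G = ⊤
  · left
    have hcomm : ∀ a b : G, a * b = b * a := fun a b =>
      Subgroup.mem_center_iff.1 (hna ▸ Subgroup.mem_top b) a
    exact ⟨hcomm, Morph.abelian_case' hcomm hpG (Morph.HM_of_morphic hpG hG)⟩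
  · right
    exact Morph.nonabelian_case hpG hG hna
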